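/- arXiv:1910.07651 — 4 statements merged into one kernel-verified Lean document; each statement's English description precedes it below -/
import Mathlib

section
/- For all n ≥ 2: (i) the number of D-permutations on [2n] equals Σ_{σ ∈ D_{2n−2}} 2^{1 + j(σ)}, where j(σ) is the number of cycles of σ that are not fixed points at even integers; and (ii) the number of Dumont permutations on [2n] equals Σ_{σ ∈ D_{2n−2}} 2^{k(σ)}, where k(σ) is the number of cycles of σ that are not fixed points. Equivalently, h_n = Σ_j h_{n−1,j} 2^{j+1} and g_{n+1} = Σ_j g_{n−1,j} 2^j, where h_{m,j} is the number of D-permutations on [2m] with exactly j cycles that are not even fixed points and g_{m,j} is the number of D-permutations on [2m] with exactly j cycles that are not fixed points. -/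
open Finset

/-- The Ferrers graph on vertex set `V ⊆ ℕ`: edges `{u,v}` with `u < v`, `u` odd, `v` even. -/
def ferrers (V : Finset ℕ) : SimpleGraph ℕ :=
  SimpleGraph.fromRel (fun u v => u ∈ V ∧ v ∈ V ∧ u < v ∧ Odd u ∧ Even v)

/-- A partition of `V` is a bond partition if each block induces a connected subgraph. -/
def IsBond (V : Finset ℕ) (P : Finpartition V) : Prop :=
  ∀ B ∈ P.parts, ((ferrers V).induce (B : Set ℕ)).Connected

/-- `u` is a (strict) descendant of `v` in the graph `G` rooted (componentwise) at `r`. -/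
def DescOf {α : Type*} (G : SimpleGraph α) (r v u : α) : Prop :=
  u ≠ v ∧ G.Reachable u r ∧ ∀ p : G.Walk u r, v ∈ p.support

/-- `F` is an increasing-decreasing (ID) forest. -/
def IsIDForest (V : Finset ℕ) (F : SimpleGraph {x // x ∈ V}) : Prop :=
  F.IsAcyclic ∧
  ∀ r v : {x // x ∈ V}, F.Reachable v r → (∀ u, F.Reachable v u → (u : ℕ) ≤ (r : ℕ)) →
    (Odd (v : ℕ) →
      (∀ u, DescOf F r v u → (v : ℕ) < (u : ℕ)) ∧
      (∀ u, F.Adj v u → DescOf F r v u → Even (u : ℕ))) ∧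
    (Even (v : ℕ) →
      (∀ u, DescOf F r v u → (u : ℕ) < (v : ℕ)) ∧
      (∀ u, F.Adj v u → DescOf F r v u → Odd (u : ℕ)))

/-- `T` is an increasing-decreasing (ID) tree. -/
def IsIDTree (V : Finset ℕ) (T : SimpleGraph {x // x ∈ V}) : Prop :=
  T.Connected ∧ IsIDForest V T

/-- A D-permutation on `A`. -/
def IsDPerm (A : Finset ℕ) (σ : Equiv.Perm {x // x ∈ A}) : Prop :=
  ∀ i : {x // x ∈ A}, (Odd (i : ℕ) → (i : ℕ) ≤ (σ i : ℕ)) ∧ (Even (i : ℕ) → (σ i : ℕ) ≤ (i : ℕ))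

/-- A D-cycle on `A`: a D-permutation which is a single cycle covering `A`. -/
def IsDCycle (A : Finset ℕ) (σ : Equiv.Perm {x // x ∈ A}) : Prop :=
  IsDPerm A σ ∧ ∀ x y : {x // x ∈ A}, σ.SameCycle x y

/-- The number of cycles (orbits, fixed points included) of a permutation. -/
noncomputable def cycleCount {α : Type*} (σ : Equiv.Perm α) : ℕ :=
  Nat.card (Quotient (⟨σ.SameCycle, Equiv.Perm.SameCycle.equivalence σ⟩ : Setoid α))

/-- A Dumont permutation on `A` (intended for `A = [2m]`). -/
def IsDumontPerm (A : Finset ℕ) (σ : Equiv.Perm {x // x ∈ A}) : Prop :=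
  ∀ i : {x // x ∈ A}, (Even (i : ℕ) → (σ i : ℕ) < (i : ℕ)) ∧ (Odd (i : ℕ) → (i : ℕ) ≤ (σ i : ℕ))

/-- A Dumont derangement on `A` (intended for `A = [2m]`). -/
def IsDumontDerangement (A : Finset ℕ) (σ : Equiv.Perm {x // x ∈ A}) : Prop :=
  ∀ i : {x // x ∈ A}, (Even (i : ℕ) → (σ i : ℕ) < (i : ℕ)) ∧ (Odd (i : ℕ) → (i : ℕ) < (σ i : ℕ))

/-- The Genocchi number `g n`: the number of Dumont permutations on `[2n-2]`. -/
noncomputable def genocchi (n : ℕ) : ℕ :=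
  Nat.card {σ : Equiv.Perm {x // x ∈ Finset.Icc 1 (2 * n - 2)} // IsDumontPerm _ σ}

/-- The median Genocchi number `h n`: the number of Dumont derangements on `[2n+2]`. -/
noncomputable def medianGenocchi (n : ℕ) : ℕ :=
  Nat.card {σ : Equiv.Perm {x // x ∈ Finset.Icc 1 (2 * n + 2)} // IsDumontDerangement _ σ}

open scoped Classical

/-- The number of fixed points of `σ` at even integers. -/
noncomputable def evenFixCount {A : Finset ℕ} (σ : Equiv.Perm {x // x ∈ A}) : ℕ :=
  (Finset.univ.filter fun i : {x // x ∈ A} => σ i = i ∧ Even (i : ℕ)).card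

/-- The number of fixed points of `σ`. -/
noncomputable def fixCount {A : Finset ℕ} (σ : Equiv.Perm {x // x ∈ A}) : ℕ :=
  (Finset.univ.filter fun i : {x // x ∈ A} => σ i = i).card

section CycleCount

variable {α β : Type*}

theorem Equiv.Perm.SameCycle.map_of_step {σ : Equiv.Perm α} {τ : Equiv.Perm β} {f : α → β}
    (hf : ∀ x, τ.SameCycle (f (σ x)) (f x)) {x y : α} (h : σ.SameCycle x y) :
    τ.SameCycle (f x) (f y) := by
  obtain ⟨i, rfl⟩ := h
  induction i using Int.induction_on with
  | zero => simp [Equiv.Perm.SameCycle.refl]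
  | succ i ih =>
    rw [add_comm, zpow_add, zpow_one, Equiv.Perm.mul_apply]
    exact ih.trans (hf _).symm
  | pred i ih =>
    have h := hf ((σ ^ (-(i : ℤ) - 1)) x)
    rw [← Equiv.Perm.mul_apply, ← zpow_one_add, add_sub_cancel] at h
    exact ih.trans h

theorem cycleCount_eq_of_maps {σ : Equiv.Perm α} {τ : Equiv.Perm β} (f : α → β) (g : β → α)
    (hf : ∀ x, τ.SameCycle (f (σ x)) (f x)) (hg : ∀ y, σ.SameCycle (g (τ y)) (g y))
    (hgf : ∀ x, σ.SameCycle (g (f x)) x) (hfg : ∀ y, τ.SameCycle (f (g y)) y) :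
    cycleCount σ = cycleCount τ := by
  refine Nat.card_congr ⟨Quotient.map f fun _ _ h => h.map_of_step hf,
    Quotient.map g fun _ _ h => h.map_of_step hg, ?_, ?_⟩
  · rintro ⟨x⟩
    exact Quotient.sound (hgf x)
  · rintro ⟨y⟩
    exact Quotient.sound (hfg y)

theorem cycleCount_permCongr (e : α ≃ β) (σ : Equiv.Perm α) :
    cycleCount (e.permCongr σ) = cycleCount σ := by
  refine (cycleCount_eq_of_maps e e.symm (fun x => ?_) (fun y => ?_) (fun x => ?_)
    (fun y => ?_)).symm
  · rw [← Equiv.Perm.sameCycle_apply_right]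
    simp [Equiv.Perm.SameCycle.refl]
  · rw [← Equiv.Perm.sameCycle_apply_right]
    simp [Equiv.Perm.SameCycle.refl]
  · simp [Equiv.Perm.SameCycle.refl]
  · simp [Equiv.Perm.SameCycle.refl]

theorem decomposeOption_symm_some_none [DecidableEq α] (σ : Equiv.Perm α) (b : α) :
    Equiv.Perm.decomposeOption.symm (some b, σ) none = some b := by
  simp

theorem decomposeOption_symm_some_some [DecidableEq α] (σ : Equiv.Perm α) (b x : α) :
    Equiv.Perm.decomposeOption.symm (some b, σ) (some x) =
      if σ x = b then none else some (σ x) := by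
  split_ifs with h
  · simp [h]
  · simp [Equiv.swap_apply_of_ne_of_ne, h]

theorem cycleCount_insert [DecidableEq α] (σ : Equiv.Perm α) (b : α) :
    cycleCount (Equiv.Perm.decomposeOption.symm (some b, σ)) = cycleCount σ := by
  set τ := Equiv.Perm.decomposeOption.symm (some b, σ)
  have hnone : τ none = some b := decomposeOption_symm_some_none σ b
  have hsome (x : α) : τ (some x) = if σ x = b then none else some (σ x) :=
    decomposeOption_symm_some_some σ b x
  refine (cycleCount_eq_of_maps some (fun z => z.getD b) (fun x => ?_) ?_ (fun x => ?_) ?_).symm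
  · by_cases h : σ x = b
    · have : τ (τ (some x)) = some (σ x) := by rw [hsome, if_pos h, hnone, h]
      rw [← this]
      simp [Equiv.Perm.SameCycle.refl]
    · have : τ (some x) = some (σ x) := by rw [hsome, if_neg h]
      rw [← this]
      simp [Equiv.Perm.SameCycle.refl]
  · rintro (_ | x)
    · simp [hnone, Equiv.Perm.SameCycle.refl]
    · rw [hsome]
      split_ifs with h
      · simp [← h, Equiv.Perm.SameCycle.refl]
      · simp [Equiv.Perm.SameCycle.refl]
  · exact Equiv.Perm.SameCycle.refl _ _
  · rintro (_ | x)
    · have : τ.SameCycle (τ none) none := by simp [Equiv.Perm.SameCycle.refl]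
      rwa [hnone] at this
    · exact Equiv.Perm.SameCycle.refl _ _

theorem cycleCount_optionCongr [Finite α] [DecidableEq α] (σ : Equiv.Perm α) :
    cycleCount (Equiv.Perm.decomposeOption.symm (none, σ)) = cycleCount σ + 1 := by
  set τ := Equiv.Perm.decomposeOption.symm (none, σ)
  have happ (z : Option α) : τ z = z.map σ := Equiv.Perm.decomposeOption_symm_of_none_apply σ z
  let s : Setoid α := ⟨σ.SameCycle, Equiv.Perm.SameCycle.equivalence σ⟩
  let s' : Setoid (Option α) := ⟨τ.SameCycle, Equiv.Perm.SameCycle.equivalence τ⟩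
  have hinv (z w : Option α) (h : τ.SameCycle z w) :
      z.map (Quotient.mk s) = w.map (Quotient.mk s) := by
    have h1 : (1 : Equiv.Perm (Option (Quotient s))).SameCycle
        (z.map (Quotient.mk s)) (w.map (Quotient.mk s)) := by
      refine h.map_of_step (fun z => ?_)
      rw [happ]
      rcases z with _ | x
      · exact Equiv.Perm.SameCycle.refl _ _
      · have : Quotient.mk s (σ x) = Quotient.mk s x :=
          Quotient.sound (Equiv.Perm.sameCycle_apply_left.2 (Equiv.Perm.SameCycle.refl _ _))
        simp [this, Equiv.Perm.SameCycle.refl]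
    simpa using h1
  have hsome (x y : α) (h : σ.SameCycle x y) : τ.SameCycle (some x) (some y) := by
    refine h.map_of_step (fun x => ?_)
    have : τ (some x) = some (σ x) := by rw [happ]; rfl
    rw [← this]
    exact Equiv.Perm.sameCycle_apply_left.2 (Equiv.Perm.SameCycle.refl _ _)
  have e : Quotient s' ≃ Option (Quotient s) :=
    { toFun := Quotient.lift (fun z => z.map (Quotient.mk s)) hinv
      invFun := fun q => q.elim (Quotient.mk s' none) (Quotient.map' some hsome)
      left_inv := by rintro ⟨_ | x⟩ <;> rfl
      right_inv := by
        rintro (_ | q)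
        · rfl
        · induction q using Quotient.ind
          rfl }
  exact (Nat.card_congr e).trans Finite.card_option

theorem card_fixed_le_cycleCount [Fintype α] (σ : Equiv.Perm α) (p : α → Prop) :
    (univ.filter fun i => σ i = i ∧ p i).card ≤ cycleCount σ := by
  rw [← Fintype.card_subtype, ← Nat.card_eq_fintype_card]
  refine Nat.card_le_card_of_injective
    (fun i => (Quotient.mk _ i.1 : Quotient (⟨σ.SameCycle, _⟩ : Setoid α))) ?_
  rintro ⟨x, hx⟩ ⟨y, hy⟩ h
  have hxy : σ.SameCycle x y := Quotient.exact h
  obtain ⟨i, hi⟩ := hxy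
  rw [Equiv.Perm.zpow_apply_eq_self_of_apply_eq_self hx.1] at hi
  exact Subtype.ext hi

end CycleCount

section WeightedEnumerator

open Polynomial

variable {α β : Type*}

/-- The weight of a fixed point at `a`: `p` at odd labels and `q` at even ones. -/
noncomputable def fixWeight (p q : ℚ) (v : α → ℕ) (a : α) : ℚ :=
  if Odd (v a) then p else q

/-- The weight of an arc `a ↦ b` of a D-permutation; it vanishes if the arc is not allowed. -/
noncomputable def arcWeight [DecidableEq α] (p q : ℚ) (v : α → ℕ) (a b : α) : ℚ :=
  if b = a then fixWeight p q v a
  else if (Odd (v a) ∧ v a < v b) ∨ (Even (v a) ∧ v b < v a) then 1 else 0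

/-- The weighted enumerator of permutations of `α` in which each element either carries a
D-permutation arc or, if its label is odd, is marked by the variable and maps anywhere. -/
noncomputable def permPoly [Fintype α] [DecidableEq α] (t p q : ℚ) (v : α → ℕ) : ℚ[X] :=
  ∑ σ : Equiv.Perm α, C (t ^ cycleCount σ) *
    ∏ a, (C (fixWeight 1 0 v a) * X + C (arcWeight p q v a (σ a)))

theorem permPoly_comp_equiv [Fintype α] [Fintype β] [DecidableEq α] [DecidableEq β]
    (t p q : ℚ) (v : β → ℕ) (e : α ≃ β) :
    permPoly t p q (v ∘ e) = permPoly t p q v := by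
  unfold permPoly
  refine Fintype.sum_equiv e.permCongr _ _ fun σ => ?_
  rw [cycleCount_permCongr]
  congr 1
  refine Fintype.prod_equiv e _ _ fun a => ?_
  simp [fixWeight, arcWeight]

theorem permPoly_option [Fintype α] [DecidableEq α] (t p q : ℚ) (v : Option α → ℕ)
    (hv : ∀ a, v (some a) < v none) :
    permPoly t p q v =
      C t * (C (fixWeight 1 0 v none) * X + C (fixWeight p q v none)) *
          permPoly t p q (v ∘ some) +
        (C (fixWeight 1 0 v none) * X + C (fixWeight 0 1 v none)) * (X + 1) *
          derivative (permPoly t p q (v ∘ some)) := by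
  set w : Equiv.Perm α → α → ℚ[X] := fun σ a =>
    C (fixWeight 1 0 (v ∘ some) a) * X + C (arcWeight p q (v ∘ some) a (σ a)) with hw
  have hcongr (σ : Equiv.Perm α) :
      ∏ a, (C (fixWeight 1 0 v a) * X +
        C (arcWeight p q v a (Equiv.Perm.decomposeOption.symm (none, σ) a))) =
      (C (fixWeight 1 0 v none) * X + C (fixWeight p q v none)) * ∏ a, w σ a := by
    rw [Fintype.prod_option]
    refine congrArg₂ _ ?_ ?_
    · simp [arcWeight]
    · refine prod_congr rfl fun a _ => ?_
      simp [hw, arcWeight, fixWeight]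
  have hinsert (σ : Equiv.Perm α) (a : α) :
      ∏ x, (C (fixWeight 1 0 v x) * X +
        C (arcWeight p q v x (Equiv.Perm.decomposeOption.symm (some (σ a), σ) x))) =
      (C (fixWeight 1 0 v none) * X + C (fixWeight 0 1 v none)) * (X + 1) *
        ((∏ x ∈ univ.erase a, w σ x) * C (fixWeight 1 0 (v ∘ some) a)) := by
    rw [Fintype.prod_option, decomposeOption_symm_some_none]
    have h1 : arcWeight p q v none (some (σ a)) = fixWeight 0 1 v none := by
      have := hv (σ a)
      have h2 : ¬ v none < v (some (σ a)) := by omega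
      simp [arcWeight, fixWeight, this, h2, ← Nat.not_odd_iff_even, ite_not]
    have h2 : ∏ x, (C (fixWeight 1 0 v (some x)) * X +
        C (arcWeight p q v (some x)
          (Equiv.Perm.decomposeOption.symm (some (σ a), σ) (some x)))) =
        (C (fixWeight 1 0 (v ∘ some) a) * (X + 1)) * ∏ x ∈ univ.erase a, w σ x := by
      rw [← mul_prod_erase univ _ (mem_univ a)]
      congr 1
      · have := hv a
        have h3 : ¬ v none < v (some a) := by omega
        rw [decomposeOption_symm_some_some, if_pos rfl]
        simp [arcWeight, fixWeight, this, h3, mul_add]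
      · refine prod_congr rfl fun x hx => ?_
        have hx' : σ x ≠ σ a := fun h => (mem_erase.1 hx).1 (σ.injective h)
        rw [decomposeOption_symm_some_some, if_neg hx']
        simp [hw, arcWeight, fixWeight]
    rw [h1, h2]
    ring
  have hsum (σ : Equiv.Perm α) : ∑ b, ∏ x, (C (fixWeight 1 0 v x) * X +
        C (arcWeight p q v x (Equiv.Perm.decomposeOption.symm (some b, σ) x))) =
      (C (fixWeight 1 0 v none) * X + C (fixWeight 0 1 v none)) * (X + 1) *
        derivative (∏ a, w σ a) := by
    rw [derivative_prod_finset, mul_sum, ← Equiv.sum_comp σ]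
    refine sum_congr rfl fun a _ => ?_
    rw [hinsert]
    simp [hw]
  unfold permPoly
  rw [← Equiv.sum_comp Equiv.Perm.decomposeOption.symm, Fintype.sum_prod_type,
    Fintype.sum_option, sum_comm, derivative_sum, mul_sum]
  simp only [cycleCount_optionCongr, cycleCount_insert, hcongr, ← mul_sum, hsum]
  refine congrArg₂ _ ?_ ?_
  · rw [mul_sum]
    refine sum_congr rfl fun σ _ => ?_
    rw [pow_succ, C_mul]
    ring
  · rw [mul_sum]
    refine sum_congr rfl fun σ _ => ?_
    rw [derivative_C_mul]
    ring

/-- The enumerator `permPoly` of the interval `[1, n]`, labelled by itself. -/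
noncomputable def intervalPoly (t p q : ℚ) (n : ℕ) : ℚ[X] :=
  permPoly t p q (Subtype.val : {x : ℕ // x ∈ Finset.Icc 1 n} → ℕ)

theorem intervalPoly_zero (t p q : ℚ) : intervalPoly t p q 0 = 1 := by
  have : IsEmpty {x // x ∈ Finset.Icc 1 0} := ⟨fun x => by simpa using x.2⟩
  simp [intervalPoly, permPoly, cycleCount]

/-- Adjoining `n + 1` to the interval `[1, n]`. -/
def optionIccEquiv (n : ℕ) :
    Option {x // x ∈ Finset.Icc 1 n} ≃ {x // x ∈ Finset.Icc 1 (n + 1)} where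
  toFun z := z.elim ⟨n + 1, by simp⟩ fun x => ⟨x, by have := mem_Icc.1 x.2; simp; omega⟩
  invFun x := if h : (x : ℕ) ∈ Finset.Icc 1 n then some ⟨x, h⟩ else none
  left_inv := by
    rintro (_ | ⟨x, hx⟩)
    · simp
    · simp_all
  right_inv := by
    rintro ⟨x, hx⟩
    by_cases h : x ∈ Finset.Icc 1 n
    · simp [h]
    · have : n + 1 = x := by simp at h hx; omega
      simp [h, this]

theorem intervalPoly_succ (t p q : ℚ) (n : ℕ) :
    intervalPoly t p q (n + 1) =
      if Even n then
        C t * (X + C p) * intervalPoly t p q n + X * (X + 1) * derivative (intervalPoly t p q n)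
      else C t * C q * intervalPoly t p q n + (X + 1) * derivative (intervalPoly t p q n) := by
  have h := permPoly_option t p q
    ((Subtype.val : {x : ℕ // x ∈ Finset.Icc 1 (n + 1)} → ℕ) ∘ optionIccEquiv n) (fun a => by
      have := mem_Icc.1 a.2
      simp [optionIccEquiv]; omega)
  rw [permPoly_comp_equiv] at h
  change intervalPoly t p q (n + 1) = _ * intervalPoly t p q n +
    _ * derivative (intervalPoly t p q n) at h
  rw [h]
  split_ifs with hn
  · have : Odd (n + 1) := hn.add_one
    simp [fixWeight, optionIccEquiv, this]
  · have : ¬ Odd (n + 1) := by simpa [Nat.odd_add_one] using hn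
    simp [fixWeight, optionIccEquiv, this]

theorem intervalPoly_odd (t p q : ℚ) (m : ℕ) :
    intervalPoly t p q (2 * m + 1) = C t * (X + C p) * intervalPoly t p q (2 * m) +
      X * (X + 1) * derivative (intervalPoly t p q (2 * m)) := by
  rw [intervalPoly_succ, if_pos (even_two_mul m)]

theorem intervalPoly_even (t p q : ℚ) (m : ℕ) :
    intervalPoly t p q (2 * m + 2) = C t * C q * intervalPoly t p q (2 * m + 1) +
      (X + 1) * derivative (intervalPoly t p q (2 * m + 1)) := by
  rw [intervalPoly_succ, if_neg (by simp)]

theorem intervalPoly_two_one_half (m : ℕ) :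
    intervalPoly 2 1 (1 / 2) (2 * m) =
      derivative ((X + 1) * intervalPoly 1 1 1 (2 * m)) := by
  have h2 : (C (2 : ℚ) : ℚ[X]) = 2 := rfl
  have h12 : (C 2 * C (1 / 2) : ℚ[X]) = 1 := by rw [← C_mul]; norm_num
  induction m with
  | zero => simp [intervalPoly_zero]
  | succ m ih =>
    rw [mul_add, mul_one, intervalPoly_even, intervalPoly_even, intervalPoly_odd,
      intervalPoly_odd, ih, h12]
    simp only [h2, C_1, derivative_mul, derivative_add, derivative_X, derivative_one,
      derivative_ofNat, derivative_zero]
    ring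

theorem intervalPoly_two_half_half (m : ℕ) :
    intervalPoly 2 (1 / 2) (1 / 2) (2 * m + 1) =
      derivative (X * intervalPoly 1 1 0 (2 * m + 2)) := by
  have h2 : (C (2 : ℚ) : ℚ[X]) = 2 := rfl
  have h12 : (2 * C (1 / 2) : ℚ[X]) = 1 := by rw [← h2, ← C_mul]; norm_num
  have hodd (k : ℕ) : intervalPoly 2 (1 / 2) (1 / 2) (2 * k + 1) =
      derivative (X * (X + 1) * intervalPoly 2 (1 / 2) (1 / 2) (2 * k)) := by
    rw [intervalPoly_odd]
    simp only [h2, mul_add, h12, derivative_mul, derivative_add, derivative_X, derivative_one]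
    ring
  induction m with
  | zero =>
    rw [hodd, intervalPoly_even, intervalPoly_odd]
    simp [intervalPoly_zero]
  | succ m ih =>
    have heven : intervalPoly 1 1 0 (2 * (m + 1) + 2) =
        (X + 1) * intervalPoly 2 (1 / 2) (1 / 2) (2 * (m + 1)) := by
      have h : intervalPoly 1 1 0 (2 * (m + 1) + 1) =
          (X + 1) * intervalPoly 2 (1 / 2) (1 / 2) (2 * m + 1) := by
        rw [ih, intervalPoly_odd, show 2 * (m + 1) = 2 * m + 2 by ring]
        simp only [C_1, derivative_mul, derivative_X]
        ring
      rw [intervalPoly_even, h, mul_add, mul_one, intervalPoly_even, h2, h12]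
      simp only [C_1, C_0, derivative_mul, derivative_add, derivative_X, derivative_one]
      ring
    rw [hodd, heven, mul_assoc]

theorem eval_zero_intervalPoly_one_one_one (m : ℕ) :
    (intervalPoly 1 1 1 (2 * m + 2)).eval 0 =
      2 * (intervalPoly 2 1 (1 / 2) (2 * m)).eval 0 := by
  rw [intervalPoly_two_one_half, intervalPoly_even, intervalPoly_odd]
  simp [derivative_mul]
  ring

theorem eval_zero_intervalPoly_one_one_zero (m : ℕ) :
    (intervalPoly 1 1 0 (2 * m + 2)).eval 0 =
      (intervalPoly 2 (1 / 2) (1 / 2) (2 * m)).eval 0 := by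
  have h := congrArg (eval 0) (intervalPoly_two_half_half m)
  rw [intervalPoly_odd] at h
  simpa [derivative_mul] using h.symm

theorem prod_arcWeight {A : Finset ℕ} (p q : ℚ) (σ : Equiv.Perm {x // x ∈ A}) :
    ∏ a, arcWeight p q (Subtype.val : {x // x ∈ A} → ℕ) a (σ a) =
      if IsDPerm A σ then
        p ^ (univ.filter fun i : {x // x ∈ A} => σ i = i ∧ Odd (i : ℕ)).card * q ^ evenFixCount σ
      else 0 := by
  split_ifs with h
  · rw [evenFixCount, ← prod_const, ← prod_const, prod_filter, prod_filter, ← prod_mul_distrib]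
    refine prod_congr rfl fun a _ => ?_
    obtain ⟨ho, he⟩ := h a
    by_cases hfix : σ a = a
    · rcases Nat.even_or_odd (a : ℕ) with ha | ha
      · simp [arcWeight, fixWeight, hfix, ha, Nat.not_odd_iff_even.2 ha]
      · simp [arcWeight, fixWeight, hfix, ha, Nat.not_even_iff_odd.2 ha]
    · have hne : (σ a : ℕ) ≠ a := fun h => hfix (Subtype.ext h)
      have : (Odd (a : ℕ) ∧ (a : ℕ) < σ a) ∨ (Even (a : ℕ) ∧ (σ a : ℕ) < a) := by
        rcases Nat.even_or_odd (a : ℕ) with ha | ha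
        · exact Or.inr ⟨ha, lt_of_le_of_ne (he ha) hne⟩
        · exact Or.inl ⟨ha, lt_of_le_of_ne (ho ha) hne.symm⟩
      rw [arcWeight, if_neg hfix, if_pos this]
      simp [hfix]
  · rw [IsDPerm, not_forall] at h
    obtain ⟨a, ha⟩ := h
    refine prod_eq_zero (mem_univ a) ?_
    have hfix : σ a ≠ a := fun h => ha (by simp [h])
    rw [arcWeight, if_neg hfix, if_neg]
    rintro (⟨h1, h2⟩ | ⟨h1, h2⟩)
    · exact ha ⟨fun _ => h2.le, fun h => absurd h1 (Nat.not_odd_iff_even.2 h)⟩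
    · exact ha ⟨fun h => absurd h (Nat.not_odd_iff_even.2 h1), fun _ => h2.le⟩

theorem eval_zero_intervalPoly (t p q : ℚ) (n : ℕ) :
    (intervalPoly t p q n).eval 0 =
      ∑ σ ∈ univ.filter fun σ : Equiv.Perm {x // x ∈ Finset.Icc 1 n} =>
        IsDPerm (Finset.Icc 1 n) σ, t ^ cycleCount σ *
          (p ^ (univ.filter fun i : {x // x ∈ Finset.Icc 1 n} => σ i = i ∧ Odd (i : ℕ)).card *
            q ^ evenFixCount σ) := by
  rw [intervalPoly, permPoly, eval_finsetSum, sum_filter]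
  refine sum_congr (by congr!) fun σ _ => ?_
  simp only [eval_mul, eval_prod, eval_add, eval_C, eval_X, mul_zero, zero_add, prod_arcWeight]
  split_ifs <;> simp

end WeightedEnumerator

theorem fixCount_eq_add {A : Finset ℕ} (σ : Equiv.Perm {x // x ∈ A}) :
    fixCount σ =
      (univ.filter fun i : {x // x ∈ A} => σ i = i ∧ Odd (i : ℕ)).card + evenFixCount σ := by
  rw [fixCount, evenFixCount, ← card_union_of_disjoint]
  · congr 1
    ext i
    have := Nat.even_or_odd (i : ℕ)
    simp only [mem_filter, mem_union, mem_univ, true_and]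
    tauto
  · rw [disjoint_filter]
    rintro i _ ⟨_, h⟩ ⟨_, h'⟩
    exact Nat.not_odd_iff_even.2 h' h

theorem evenFixCount_le_cycleCount {A : Finset ℕ} (σ : Equiv.Perm {x // x ∈ A}) :
    evenFixCount σ ≤ cycleCount σ := by
  unfold evenFixCount
  convert card_fixed_le_cycleCount σ fun i => Even (i : ℕ)

theorem fixCount_le_cycleCount {A : Finset ℕ} (σ : Equiv.Perm {x // x ∈ A}) :
    fixCount σ ≤ cycleCount σ := by
  unfold fixCount
  convert card_fixed_le_cycleCount σ fun _ => True using 3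
  simp

theorem two_pow_mul_half_pow {a b : ℕ} (h : b ≤ a) :
    (2 : ℚ) ^ a * (1 / 2) ^ b = 2 ^ (a - b) := by
  rw [one_div, inv_pow, pow_sub₀ _ two_ne_zero h]

theorem isDumontPerm_iff {A : Finset ℕ} (σ : Equiv.Perm {x // x ∈ A}) :
    IsDumontPerm A σ ↔ IsDPerm A σ ∧ evenFixCount σ = 0 := by
  rw [evenFixCount, card_eq_zero, filter_eq_empty_iff]
  constructor
  · refine fun h => ⟨fun i => ⟨(h i).2, fun hi => ((h i).1 hi).le⟩, fun i _ hi => ?_⟩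
    have := (h i).1 hi.2
    rw [hi.1] at this
    exact this.false
  · rintro ⟨h, h0⟩ i
    exact ⟨fun hi => lt_of_le_of_ne ((h i).2 hi) fun he => h0 (mem_univ i) ⟨Subtype.ext he, hi⟩,
      (h i).1⟩

theorem card_isDPerm_eq_eval (n : ℕ) :
    (Nat.card {σ : Equiv.Perm {x // x ∈ Finset.Icc 1 n} // IsDPerm (Finset.Icc 1 n) σ} : ℚ) =
      (intervalPoly 1 1 1 n).eval 0 := by
  rw [eval_zero_intervalPoly, Nat.card_eq_fintype_card, Fintype.card_subtype]
  simp

theorem card_isDumontPerm_eq_eval (n : ℕ) :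
    (Nat.card {σ : Equiv.Perm {x // x ∈ Finset.Icc 1 n} //
        IsDumontPerm (Finset.Icc 1 n) σ} : ℚ) =
      (intervalPoly 1 1 0 n).eval 0 := by
  rw [eval_zero_intervalPoly, Nat.card_eq_fintype_card, Fintype.card_subtype]
  simp only [isDumontPerm_iff, one_pow, one_mul, zero_pow_eq, sum_ite, sum_const_zero, add_zero,
    sum_const, nsmul_eq_mul, mul_one, filter_filter]

/-- (i) `|D_{2n}| = Σ_{σ ∈ D_{2n-2}} 2^{1+j(σ)}` where `j(σ)` is the number of cycles of `σ`
that are not even fixed points, and (ii) the number of Dumont permutations on `[2n]` equals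
`Σ_{σ ∈ D_{2n-2}} 2^{k(σ)}` where `k(σ)` is the number of cycles of `σ` that are not fixed
points. -/
theorem stmt14 (n : ℕ) (hn : 2 ≤ n) :
    (Nat.card {σ : Equiv.Perm {x // x ∈ Finset.Icc 1 (2 * n)} //
        IsDPerm (Finset.Icc 1 (2 * n)) σ} =
      ∑ σ ∈ Finset.univ.filter
        fun σ : Equiv.Perm {x // x ∈ Finset.Icc 1 (2 * n - 2)} =>
          IsDPerm (Finset.Icc 1 (2 * n - 2)) σ,
        2 ^ (1 + (cycleCount σ - evenFixCount σ))) ∧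
    (Nat.card {σ : Equiv.Perm {x // x ∈ Finset.Icc 1 (2 * n)} //
        IsDumontPerm (Finset.Icc 1 (2 * n)) σ} =
      ∑ σ ∈ Finset.univ.filter
        fun σ : Equiv.Perm {x // x ∈ Finset.Icc 1 (2 * n - 2)} =>
          IsDPerm (Finset.Icc 1 (2 * n - 2)) σ,
        2 ^ (cycleCount σ - fixCount σ)) := by
  obtain ⟨m, rfl⟩ : ∃ m, n = m + 1 := ⟨n - 1, by omega⟩
  have hm : 2 * (m + 1) - 2 = 2 * m := by omega
  rw [hm]
  constructor
  · apply Nat.cast_injective (R := ℚ)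
    rw [card_isDPerm_eq_eval, mul_add, mul_one, eval_zero_intervalPoly_one_one_one,
      eval_zero_intervalPoly, mul_sum, Nat.cast_sum]
    refine sum_congr rfl fun σ _ => ?_
    rw [one_pow, one_mul, two_pow_mul_half_pow (evenFixCount_le_cycleCount σ), pow_add]
    norm_num
  · apply Nat.cast_injective (R := ℚ)
    rw [card_isDumontPerm_eq_eval, mul_add, mul_one, eval_zero_intervalPoly_one_one_zero,
      eval_zero_intervalPoly, Nat.cast_sum]
    refine sum_congr rfl fun σ _ => ?_
    rw [← pow_add, ← fixCount_eq_add, two_pow_mul_half_pow (fixCount_le_cycleCount σ)]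
    norm_num
end

section
/- For all n ≥ 1, there exists a bijection φ from the set D_{2n} of D-permutations on [2n] onto the set of surjective staircases f ∈ E_{2n+2} having no even maxima, such that for every σ ∈ D_{2n} and every j ∈ [2n]: (1) j is an even cycle maximum of σ (i.e., j is even and is the largest element of its orbit under σ) if and only if j is a fixed point of φ(σ); (2) j is an even fixed point of σ if and only if j is an isolated fixed point of φ(σ); and (3) j is an odd fixed point of σ if and only if j is an odd maximum of φ(σ). -/
open Finset

/-- A surjective staircase on `[m]` (intended for even `m`): an excedent function whose image
is exactly the set of even elements of `[m]`. -/
def IsSurjStaircase (m : ℕ) (f : {x // x ∈ Finset.Icc 1 m} → {x // x ∈ Finset.Icc 1 m}) :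
    Prop :=
  (∀ i : {x // x ∈ Finset.Icc 1 m}, (i : ℕ) ≤ (f i : ℕ)) ∧
    ∀ j : {x // x ∈ Finset.Icc 1 m}, (Even (j : ℕ) ↔ ∃ i, f i = j)

/-- `FirstReach τ t x y`: among `τ x, τ (τ x), …`, the first element that is at least `t`
is `y`. -/
inductive FirstReach {α : Type*} [LinearOrder α] (τ : Equiv.Perm α) (t : α) : α → α → Prop
  | here {x : α} : t ≤ τ x → FirstReach τ t x (τ x)
  | step {x y : α} : τ x < t → FirstReach τ t (τ x) y → FirstReach τ t x y

namespace FirstReach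

variable {α β : Type*} [LinearOrder α] [LinearOrder β] {τ : Equiv.Perm α} {t x y : α}

theorem unique {z : α} (h : FirstReach τ t x y) (h' : FirstReach τ t x z) : y = z := by
  induction h with
  | here hx =>
    cases h' with
    | here => rfl
    | step hx' _ => exact absurd hx' hx.not_gt
  | step hx _ ih =>
    cases h' with
    | here hx' => exact absurd hx hx'.not_gt
    | step _ h'' => exact ih h''

theorem le (h : FirstReach τ t x y) : t ≤ y := by
  induction h <;> assumption

theorem symm_apply_le (h : FirstReach τ t x y) (hx : x ≤ t) : τ.symm y ≤ t := by
  induction h with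
  | here => simpa using hx
  | step hx' _ ih => exact ih hx'.le

theorem sameCycle (h : FirstReach τ t x y) : τ.SameCycle x y := by
  induction h with
  | here => exact Equiv.Perm.sameCycle_apply_right.2 (Equiv.Perm.SameCycle.refl _ _)
  | step _ _ ih => exact Equiv.Perm.sameCycle_apply_left.1 ih

theorem pow_apply_le (ht : FirstReach τ t t t) (k : ℕ) :
    ∀ x, x ≤ t → FirstReach τ t x t → (τ ^ k) x ≤ t := by
  induction k with
  | zero => intro x hx _; simpa using hx
  | succ k ih =>
    intro x _ h
    rw [pow_succ, Equiv.Perm.mul_apply]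
    generalize hy : t = y at h
    cases h with
    | here _ => rw [← hy]; exact ih t le_rfl ht
    | step hx h => subst hy; exact ih _ hx.le h

theorem exists_of_le_pow (k : ℕ) : ∀ x, t ≤ (τ ^ (k + 1)) x → ∃ y, FirstReach τ t x y := by
  induction k with
  | zero => intro x hx; exact ⟨_, .here (by simpa using hx)⟩
  | succ k ih =>
    intro x hx
    rcases le_or_gt t (τ x) with h | h
    · exact ⟨_, .here h⟩
    · rw [pow_succ, Equiv.Perm.mul_apply] at hx
      obtain ⟨y, hy⟩ := ih _ hx
      exact ⟨y, .step h hy⟩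

theorem exists_self [Finite α] (τ : Equiv.Perm α) (t : α) : ∃ y, FirstReach τ t t y := by
  obtain ⟨k, hk, h⟩ := (isOfFinOrder_of_finite τ).exists_pow_eq_one
  obtain ⟨k, rfl⟩ := Nat.exists_eq_succ_of_ne_zero hk.ne'
  exact exists_of_le_pow k t (by rw [Nat.succ_eq_add_one] at h; rw [h]; rfl)

theorem map (e : α ≃o β) (h : FirstReach τ t x y) :
    FirstReach (e.toEquiv.permCongr τ) (e t) (e x) (e y) := by
  have key : ∀ x, e.toEquiv.permCongr τ (e x) = e (τ x) := fun x => by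
    simp [Equiv.permCongr_apply]
  induction h with
  | @here x hx =>
    rw [← key x]
    exact .here (by rw [key]; exact e.monotone hx)
  | @step x y hx _ ih =>
    refine .step ?_ ?_ <;> rw [key]
    · exact e.strictMono hx
    · exact ih

theorem decomposeFin_succ {n : ℕ} {p : Fin (n + 1)} {e : Equiv.Perm (Fin n)} {t x y : Fin n}
    (h : FirstReach e t x y) :
    FirstReach (Equiv.Perm.decomposeFin.symm (p, e)) t.succ x.succ y.succ := by
  set τ := Equiv.Perm.decomposeFin.symm (p, e) with hτ
  have key : ∀ x z, FirstReach τ t.succ (e x).succ z → e x < t → FirstReach τ t.succ x.succ z := by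
    intro x z h hx
    by_cases hp : (e x).succ = p
    · have h1 : τ x.succ = 0 := by simp [hτ, hp]
      have h0 : τ 0 = (e x).succ := by simp [hτ, hp]
      refine .step (by rw [h1]; exact Fin.succ_pos t) ?_
      rw [h1]
      exact .step (by rw [h0]; exact Fin.succ_lt_succ_iff.2 hx) (by rwa [h0])
    · have h1 : τ x.succ = (e x).succ := by
        simp only [hτ, Equiv.Perm.decomposeFin_symm_apply_succ]
        exact Equiv.swap_apply_of_ne_of_ne (Fin.succ_ne_zero _) hp
      exact .step (by rw [h1]; exact Fin.succ_lt_succ_iff.2 hx) (by rwa [h1])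
  induction h with
  | @here x hx =>
    by_cases hp : (e x).succ = p
    · have h1 : τ x.succ = 0 := by simp [hτ, hp]
      have h0 : τ 0 = (e x).succ := by simp [hτ, hp]
      refine .step (by rw [h1]; exact Fin.succ_pos t) ?_
      rw [h1, ← h0]
      exact .here (by rw [h0]; exact Fin.succ_le_succ_iff.2 hx)
    · have h1 : τ x.succ = (e x).succ := by
        simp only [hτ, Equiv.Perm.decomposeFin_symm_apply_succ]
        exact Equiv.swap_apply_of_ne_of_ne (Fin.succ_ne_zero _) hp
      rw [← h1]
      exact .here (by rw [h1]; exact Fin.succ_le_succ_iff.2 hx)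
  | @step x y hx _ ih => exact key x _ ih hx

theorem existsUnique_fin (n : ℕ) (F : Fin n → Fin n) (hF : ∀ i, i ≤ F i) :
    ∃! τ : Equiv.Perm (Fin n), ∀ i, FirstReach τ i i (F i) := by
  induction n with
  | zero => exact ⟨1, fun i => i.elim0, fun _ _ => Subsingleton.elim _ _⟩
  | succ n ih =>
    have hne : ∀ i : Fin n, F i.succ ≠ 0 := fun i h => by
      have := hF i.succ
      rw [h] at this
      exact absurd this (Fin.succ_pos i).not_ge
    obtain ⟨e, he, huniq⟩ := ih (fun i => (F i.succ).pred (hne i)) fun i => by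
      rw [← Fin.succ_le_succ_iff, Fin.succ_pred]; exact hF _
    refine ⟨Equiv.Perm.decomposeFin.symm (F 0, e), fun i => ?_, fun τ hτ => ?_⟩
    · refine Fin.cases ?_ (fun i => ?_) i
      · have h0 : Equiv.Perm.decomposeFin.symm (F 0, e) 0 = F 0 := by simp
        have := FirstReach.here (τ := Equiv.Perm.decomposeFin.symm (F 0, e)) (x := 0)
          (Fin.zero_le _)
        rwa [h0] at this
      · simpa using (he i).decomposeFin_succ (p := F 0)
    · obtain ⟨⟨p, e'⟩, rfl⟩ := Equiv.Perm.decomposeFin.symm.surjective τ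
      have hp : p = F 0 := by
        refine FirstReach.unique (τ := Equiv.Perm.decomposeFin.symm (p, e')) (t := 0) ?_ (hτ 0)
        have := FirstReach.here (τ := Equiv.Perm.decomposeFin.symm (p, e')) (x := 0)
          (Fin.zero_le _)
        simpa using this
      rw [hp, huniq e' fun i => ?_]
      obtain ⟨y, hy⟩ := exists_self e' i
      have := (hy.decomposeFin_succ (p := p)).unique (hτ i.succ)
      simpa [← this] using hy

theorem existsUnique_perm [Finite α] (F : α → α) (hF : ∀ i, i ≤ F i) :
    ∃! τ : Equiv.Perm α, ∀ i, FirstReach τ i i (F i) := by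
  have := Fintype.ofFinite α
  let e : α ≃o Fin (Fintype.card α) := (Fintype.orderIsoFinOfCardEq α rfl).symm
  have key : ∀ τ : Equiv.Perm α, (∀ i, FirstReach τ i i (F i)) ↔
      ∀ i, FirstReach (e.toEquiv.permCongr τ) i i (e (F (e.symm i))) := by
    refine fun τ => ⟨fun h i => ?_, fun h i => ?_⟩
    · simpa using (h (e.symm i)).map e
    · have := (h (e i)).map e.symm
      have hs : e.symm.toEquiv.permCongr (e.toEquiv.permCongr τ) = τ := by
        ext; simp [Equiv.permCongr_apply]
      rw [hs] at this
      simpa using this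
  obtain ⟨τ, hτ, huniq⟩ := existsUnique_fin _ (fun i => e (F (e.symm i))) fun i => by
    rw [← e.symm_apply_le]; exact hF _
  refine ⟨e.toEquiv.permCongr.symm τ, (key _).2 ?_, fun τ' h => ?_⟩
  · rw [Equiv.apply_symm_apply]
    exact hτ
  rw [Equiv.eq_symm_apply]
  exact huniq _ ((key _).1 h)

end FirstReach

/-- The first element that is at least `i` met when walking backwards from `i` along its cycle
under `σ`. -/
noncomputable def permCode {α : Type*} [LinearOrder α] [Finite α] (σ : Equiv.Perm α) (i : α) : α :=
  (FirstReach.exists_self σ⁻¹ i).choose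

section permCode

variable {α : Type*} [LinearOrder α] [Finite α] (σ : Equiv.Perm α)

theorem firstReach_permCode (i : α) : FirstReach σ⁻¹ i i (permCode σ i) :=
  (FirstReach.exists_self σ⁻¹ i).choose_spec

theorem le_permCode (i : α) : i ≤ permCode σ i :=
  (firstReach_permCode σ i).le

theorem apply_permCode_le (i : α) : σ (permCode σ i) ≤ i :=
  (firstReach_permCode σ i).symm_apply_le le_rfl

variable {σ}

theorem permCode_apply {j : α} (h : σ j ≤ j) : permCode σ (σ j) = j := by
  refine (firstReach_permCode σ _).unique ?_
  have := FirstReach.here (τ := σ⁻¹) (t := σ j) (x := σ j) (by simpa using h)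
  simpa using this

theorem permCode_eq_self_iff {j : α} :
    permCode σ j = j ↔ ∀ x, σ.SameCycle j x → x ≤ j := by
  refine ⟨fun h x hx => ?_, fun h => le_antisymm (h _ ?_) (le_permCode σ j)⟩
  · have hj := firstReach_permCode σ j
    rw [h] at hj
    obtain ⟨k, rfl⟩ := (Equiv.Perm.sameCycle_inv.2 hx).exists_nat_pow_eq
    exact hj.pow_apply_le k j le_rfl hj
  · exact Equiv.Perm.sameCycle_inv.1 (firstReach_permCode σ j).sameCycle

theorem exists_permCode_eq_iff {j : α} : (∃ i, permCode σ i = j) ↔ σ j ≤ j := by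
  refine ⟨?_, fun h => ⟨_, permCode_apply h⟩⟩
  rintro ⟨i, rfl⟩
  exact (apply_permCode_le σ i).trans (le_permCode σ i)

theorem forall_permCode_eq_iff {j : α} : (∀ i, permCode σ i = j → i = j) ↔ j ≤ σ j := by
  refine ⟨fun h => ?_, ?_⟩
  · by_contra! hlt
    exact hlt.ne (h _ (permCode_apply hlt.le))
  · rintro h i rfl
    exact le_antisymm (le_permCode σ i) (h.trans (apply_permCode_le σ i))

theorem apply_eq_self_iff_permCode {j : α} :
    σ j = j ↔ permCode σ j = j ∧ ∀ i, permCode σ i = j → i = j := by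
  rw [forall_permCode_eq_iff]
  refine ⟨fun h => ⟨?_, h.ge⟩, fun h => le_antisymm (exists_permCode_eq_iff.1 ⟨j, h.1⟩) h.2⟩
  simpa [h] using permCode_apply h.le

theorem permCode_injective : Function.Injective (permCode : Equiv.Perm α → α → α) := by
  intro σ σ' h
  refine inv_injective ((FirstReach.existsUnique_perm _ (le_permCode σ)).unique
    (firstReach_permCode σ) ?_)
  rw [h]
  exact firstReach_permCode σ'

theorem exists_permCode_eq (F : α → α) (hF : ∀ i, i ≤ F i) :
    ∃ σ : Equiv.Perm α, permCode σ = F := by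
  obtain ⟨τ, hτ, -⟩ := FirstReach.existsUnique_perm F hF
  refine ⟨τ⁻¹, funext fun i => (firstReach_permCode τ⁻¹ i).unique ?_⟩
  rw [inv_inv]
  exact hτ i

end permCode

theorem isDPerm_iff_permCode {A : Finset ℕ} {σ : Equiv.Perm {x // x ∈ A}} :
    IsDPerm A σ ↔ ∀ j : {x // x ∈ A}, (Odd (j : ℕ) → ∀ i, permCode σ i = j → i = j) ∧
      (Even (j : ℕ) → ∃ i, permCode σ i = j) := by
  simp only [forall_permCode_eq_iff, exists_permCode_eq_iff]
  rfl

/-- Extend `F` from `[2n]` to `[2n+2]` by the value `2n+2`, which also replaces the value of `F`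
at its odd fixed points. -/
def extendStaircase (n : ℕ) (F : {x // x ∈ Finset.Icc 1 (2 * n)} → {x // x ∈ Finset.Icc 1 (2 * n)})
    (j : {x // x ∈ Finset.Icc 1 (2 * n + 2)}) : {x // x ∈ Finset.Icc 1 (2 * n + 2)} :=
  if h : (j : ℕ) ∈ Finset.Icc 1 (2 * n) then
    if Odd (j : ℕ) ∧ F ⟨j, h⟩ = ⟨j, h⟩ then ⟨2 * n + 2, by simp⟩
    else ⟨F ⟨j, h⟩, Finset.Icc_subset_Icc_right (by omega) (F ⟨j, h⟩).2⟩
  else ⟨2 * n + 2, by simp⟩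

section extendStaircase

variable {n : ℕ} {F : {x // x ∈ Finset.Icc 1 (2 * n)} → {x // x ∈ Finset.Icc 1 (2 * n)}}

theorem extendStaircase_eq_iff {i j : ℕ} (hi : i ∈ Finset.Icc 1 (2 * n + 2))
    (hj : j ∈ Finset.Icc 1 (2 * n)) (hj2 : j ∈ Finset.Icc 1 (2 * n + 2)) :
    extendStaircase n F ⟨i, hi⟩ = ⟨j, hj2⟩ ↔
      ∃ hi' : i ∈ Finset.Icc 1 (2 * n), F ⟨i, hi'⟩ = ⟨j, hj⟩ ∧ ¬(Odd i ∧ i = j) := by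
  have := Finset.mem_Icc.1 hj
  unfold extendStaircase
  split_ifs with h h' <;> simp only [Subtype.ext_iff] at * <;> grind

theorem extendStaircase_eq_top_iff {i : ℕ} (hi : i ∈ Finset.Icc 1 (2 * n + 2))
    (hi' : i ∈ Finset.Icc 1 (2 * n)) :
    (extendStaircase n F ⟨i, hi⟩ : ℕ) = 2 * n + 2 ↔ Odd i ∧ F ⟨i, hi'⟩ = ⟨i, hi'⟩ := by
  have := Finset.mem_Icc.1 (F ⟨i, hi'⟩).2
  unfold extendStaircase
  split_ifs with h <;> simp only [Subtype.ext_iff] at * <;> grind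

theorem extendStaircase_ne_top (j : {x // x ∈ Finset.Icc 1 (2 * n + 2)}) (hj : (j : ℕ) ≤ 2 * n)
    (he : Even (j : ℕ)) : (extendStaircase n F j : ℕ) ≠ 2 * n + 2 := by
  have := Finset.mem_Icc.1 j.2
  rw [Ne, extendStaircase_eq_top_iff j.2 (Finset.mem_Icc.2 ⟨this.1, hj⟩)]
  grind

theorem isSurjStaircase_extendStaircase (hF : ∀ i, i ≤ F i)
    (hD : ∀ j : {x // x ∈ Finset.Icc 1 (2 * n)}, (Odd (j : ℕ) → ∀ i, F i = j → i = j) ∧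
      (Even (j : ℕ) → ∃ i, F i = j)) :
    IsSurjStaircase (2 * n + 2) (extendStaircase n F) := by
  refine ⟨fun i => ?_, fun j => ?_⟩
  · have := Finset.mem_Icc.1 i.2
    unfold extendStaircase
    split_ifs with h
    · exact this.2
    · exact hF ⟨i, h⟩
    · exact this.2
  · obtain ⟨j, hj2⟩ := j
    by_cases hj : j ∈ Finset.Icc 1 (2 * n)
    · refine ⟨fun he => ?_, ?_⟩
      · obtain ⟨i, hi⟩ := (hD ⟨j, hj⟩).2 he
        have hi2 : (i : ℕ) ∈ Finset.Icc 1 (2 * n + 2) :=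
          Finset.Icc_subset_Icc_right (by omega) i.2
        exact ⟨⟨i, hi2⟩, (extendStaircase_eq_iff hi2 hj hj2).2 ⟨i.2, hi, by grind⟩⟩
      · rintro ⟨i, hi⟩
        obtain ⟨hi', h, hne⟩ := (extendStaircase_eq_iff i.2 hj hj2).1 hi
        by_contra ho
        rw [Nat.not_even_iff_odd] at ho
        have : (i : ℕ) = j := congrArg Subtype.val ((hD ⟨j, hj⟩).1 ho _ h)
        exact hne ⟨this ▸ ho, this⟩
    · rw [Finset.mem_Icc] at hj hj2
      have htop : extendStaircase n F ⟨2 * n + 2, by simp⟩ = ⟨2 * n + 2, by simp⟩ := by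
        simp [extendStaircase]
      refine ⟨fun he => ?_, ?_⟩
      · obtain rfl : j = 2 * n + 2 := by grind
        exact ⟨_, htop⟩
      · rintro ⟨i, hi⟩
        have hv : (extendStaircase n F i : ℕ) = j := congrArg Subtype.val hi
        unfold extendStaircase at hv
        split_ifs at hv with h
        · grind
        · have := Finset.mem_Icc.1 (F ⟨i, h⟩).2
          grind
        · grind

theorem extendStaircase_injective : Function.Injective (extendStaircase n) := by
  intro F F' h
  funext i
  have hi2 : (i : ℕ) ∈ Finset.Icc 1 (2 * n + 2) := Finset.Icc_subset_Icc_right (by omega) i.2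
  have hj2 : ((F i : ℕ)) ∈ Finset.Icc 1 (2 * n + 2) :=
    Finset.Icc_subset_Icc_right (by omega) (F i).2
  by_cases hi : Odd (i : ℕ) ∧ F i = i
  · have := (extendStaircase_eq_top_iff hi2 i.2).2 hi
    rw [h, extendStaircase_eq_top_iff hi2 i.2] at this
    exact hi.2.trans this.2.symm
  · have := (extendStaircase_eq_iff (F := F) hi2 (F i).2 hj2).2
      ⟨i.2, rfl, fun h' => hi ⟨h'.1, Subtype.ext h'.2.symm⟩⟩
    rw [h, extendStaircase_eq_iff hi2 (F i).2 hj2] at this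
    exact this.2.1.symm

theorem exists_extendStaircase_eq
    {f : {x // x ∈ Finset.Icc 1 (2 * n + 2)} → {x // x ∈ Finset.Icc 1 (2 * n + 2)}}
    (hf : IsSurjStaircase (2 * n + 2) f)
    (hmax : ∀ j : {x // x ∈ Finset.Icc 1 (2 * n + 2)},
      (j : ℕ) ≤ 2 * n → Even (j : ℕ) → ((f j : ℕ) ≠ 2 * n + 2)) :
    ∃ F : {x // x ∈ Finset.Icc 1 (2 * n)} → {x // x ∈ Finset.Icc 1 (2 * n)},
      (∀ i, i ≤ F i) ∧
      (∀ j : {x // x ∈ Finset.Icc 1 (2 * n)}, (Odd (j : ℕ) → ∀ i, F i = j → i = j) ∧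
        (Even (j : ℕ) → ∃ i, F i = j)) ∧
      extendStaircase n F = f := by
  have hsub : Finset.Icc 1 (2 * n) ⊆ Finset.Icc 1 (2 * n + 2) :=
    Finset.Icc_subset_Icc_right (by omega)
  have heven : ∀ i, Even (f i : ℕ) := fun i => (hf.2 _).2 ⟨i, rfl⟩
  have hmem : ∀ i, 1 ≤ (f i : ℕ) ∧ (f i : ℕ) ≤ 2 * n + 2 := fun i => Finset.mem_Icc.1 (f i).2
  have hle : ∀ i : {x // x ∈ Finset.Icc 1 (2 * n + 2)}, (i : ℕ) ≤ (f i : ℕ) := hf.1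
  let F : {x // x ∈ Finset.Icc 1 (2 * n)} → {x // x ∈ Finset.Icc 1 (2 * n)} := fun i =>
    if h : (f ⟨i, hsub i.2⟩ : ℕ) ∈ Finset.Icc 1 (2 * n) then ⟨_, h⟩ else i
  have hF : ∀ i, (F i : ℕ) =
      if (f ⟨i, hsub i.2⟩ : ℕ) ≤ 2 * n then (f ⟨i, hsub i.2⟩ : ℕ) else i := by
    intro i
    have := hmem ⟨i, hsub i.2⟩
    simp only [F, Finset.mem_Icc]
    split_ifs <;> grind
  refine ⟨F, fun i => ?_, fun j => ⟨fun ho i hi => ?_, fun he => ?_⟩, funext fun i => ?_⟩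
  · have := hle ⟨i, hsub i.2⟩
    rw [← Subtype.coe_le_coe, hF]
    split_ifs
    exacts [this, le_rfl]
  · have h := hF i
    rw [hi] at h
    split_ifs at h with h'
    · have := heven ⟨i, hsub i.2⟩
      grind
    · exact Subtype.ext h.symm
  · obtain ⟨i, hi⟩ := (hf.2 ⟨j, hsub j.2⟩).1 he
    have hi' := hle i
    have hj := Finset.mem_Icc.1 j.2
    have h1 := Finset.mem_Icc.1 i.2
    have hv : (f i : ℕ) = j := congrArg Subtype.val hi
    refine ⟨⟨i, Finset.mem_Icc.2 ⟨h1.1, by omega⟩⟩, Subtype.ext ?_⟩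
    rw [hF]
    simp only [Subtype.coe_eta, hv]
    exact if_pos hj.2
  · have h1 := Finset.mem_Icc.1 i.2
    have h2 := hmem i
    have h3 := heven i
    have h4 := hle i
    have h5 := hmax i
    refine Subtype.ext ?_
    unfold extendStaircase
    rw [Nat.even_iff] at h3
    split_ifs with h h'
    · have h6 := hF ⟨i, h⟩
      have h7 := Nat.odd_iff.1 h'.1
      rw [h'.2] at h6
      simp only [Subtype.coe_eta] at h6 ⊢
      split_ifs at h6 <;> omega
    · have h6 := hF ⟨i, h⟩
      rw [Subtype.ext_iff, Nat.odd_iff] at h'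
      rw [Nat.even_iff] at h5
      simp only [Subtype.coe_eta] at h6 h' ⊢
      rw [Finset.mem_Icc] at h
      split_ifs at h6 <;> omega
    · rw [Finset.mem_Icc] at h
      simp only
      omega

end extendStaircase

/-- There is a bijection `φ` from the D-permutations on `[2n]` onto the surjective staircases
on `[2n+2]` with no even maxima such that for all `σ` and `j ∈ [2n]`: (1) `j` is an even cycle
maximum of `σ` iff `j` is a fixed point of `φ(σ)`; (2) `j` is an even fixed point of `σ` iff
`j` is an isolated fixed point of `φ(σ)`; (3) `j` is an odd fixed point of `σ` iff `j` is an
odd maximum of `φ(σ)`. -/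
theorem stmt15 (n : ℕ) (hn : 1 ≤ n) :
    ∃ φ : {σ : Equiv.Perm {x // x ∈ Finset.Icc 1 (2 * n)} //
            IsDPerm (Finset.Icc 1 (2 * n)) σ} ≃
          {f : {x // x ∈ Finset.Icc 1 (2 * n + 2)} → {x // x ∈ Finset.Icc 1 (2 * n + 2)} //
            IsSurjStaircase (2 * n + 2) f ∧
            ∀ j : {x // x ∈ Finset.Icc 1 (2 * n + 2)},
              (j : ℕ) ≤ 2 * n → Even (j : ℕ) → ((f j : ℕ) ≠ 2 * n + 2)},
      ∀ (σ : {σ : Equiv.Perm {x // x ∈ Finset.Icc 1 (2 * n)} //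
            IsDPerm (Finset.Icc 1 (2 * n)) σ})
        (j : ℕ) (hj : j ∈ Finset.Icc 1 (2 * n)) (hj2 : j ∈ Finset.Icc 1 (2 * n + 2)),
        ((Even j ∧ ∀ x, (σ.1).SameCycle ⟨j, hj⟩ x → (x : ℕ) ≤ j) ↔
            (φ σ).1 ⟨j, hj2⟩ = ⟨j, hj2⟩) ∧
        ((Even j ∧ σ.1 ⟨j, hj⟩ = ⟨j, hj⟩) ↔
            ((φ σ).1 ⟨j, hj2⟩ = ⟨j, hj2⟩ ∧ ∀ i, (φ σ).1 i = ⟨j, hj2⟩ → i = ⟨j, hj2⟩)) ∧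
        ((Odd j ∧ σ.1 ⟨j, hj⟩ = ⟨j, hj⟩) ↔ (Odd j ∧ ((φ σ).1 ⟨j, hj2⟩ : ℕ) = 2 * n + 2)) := by
  let φ : {σ : Equiv.Perm {x // x ∈ Finset.Icc 1 (2 * n)} //
            IsDPerm (Finset.Icc 1 (2 * n)) σ} →
          {f : {x // x ∈ Finset.Icc 1 (2 * n + 2)} → {x // x ∈ Finset.Icc 1 (2 * n + 2)} //
            IsSurjStaircase (2 * n + 2) f ∧
            ∀ j : {x // x ∈ Finset.Icc 1 (2 * n + 2)},
              (j : ℕ) ≤ 2 * n → Even (j : ℕ) → ((f j : ℕ) ≠ 2 * n + 2)} :=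
    fun σ => ⟨extendStaircase n (permCode σ.1),
      isSurjStaircase_extendStaircase (le_permCode σ.1) (isDPerm_iff_permCode.1 σ.2),
      extendStaircase_ne_top⟩
  have hφ : Function.Bijective φ := by
    refine ⟨fun σ σ' h => Subtype.ext (permCode_injective
      (extendStaircase_injective (congrArg Subtype.val h))), fun f => ?_⟩
    obtain ⟨F, hF, hD, hf⟩ := exists_extendStaircase_eq f.2.1 f.2.2
    obtain ⟨σ, rfl⟩ := exists_permCode_eq F hF
    exact ⟨⟨σ, isDPerm_iff_permCode.2 hD⟩, Subtype.ext hf⟩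
  refine ⟨Equiv.ofBijective φ hφ, fun σ j hj hj2 => ?_⟩
  have hD := isDPerm_iff_permCode.1 σ.2 ⟨j, hj⟩
  simp only [Equiv.ofBijective_apply, φ]
  have h1 : extendStaircase n (permCode σ.1) ⟨j, hj2⟩ = ⟨j, hj2⟩ ↔
      Even j ∧ permCode σ.1 ⟨j, hj⟩ = ⟨j, hj⟩ := by
    rw [extendStaircase_eq_iff hj2 hj hj2]
    grind
  refine ⟨?_, ?_, ?_⟩
  · rw [h1, permCode_eq_self_iff]
    exact Iff.rfl
  · rw [h1, apply_eq_self_iff_permCode, and_assoc]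
    refine and_congr_right fun he => and_congr_right fun _ => ⟨fun h i hi => ?_, fun h i hi => ?_⟩
    · obtain ⟨hi', h', -⟩ := (extendStaircase_eq_iff i.2 hj hj2).1 hi
      exact Subtype.ext (congrArg Subtype.val (h _ h') :)
    · have hi2 : (i : ℕ) ∈ Finset.Icc 1 (2 * n + 2) :=
        Finset.Icc_subset_Icc_right (by omega) i.2
      have := h ⟨i, hi2⟩ ((extendStaircase_eq_iff hi2 hj hj2).2 ⟨i.2, hi, by grind⟩)
      exact Subtype.ext (congrArg Subtype.val this :)
  · rw [extendStaircase_eq_top_iff hj2 hj, ← and_assoc, and_self]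
    refine and_congr_right fun ho => ?_
    rw [apply_eq_self_iff_permCode]
    exact and_iff_left (hD.1 ho)
end

section
/- For all n ≥ 1, the polynomial identity (2n)! · χ_{2n}(t) = Σ_{k=0}^{2n−1} d(2n,k) · (t+1)(t+2)⋯(t+k) · (t−1)(t−2)⋯(t−(2n−1−k)) holds, where χ_{2n}(t) is the characteristic polynomial of the bond lattice Π_{Γ_{2n}}, d(2n,k) is the number of permutations of [2n] having exactly k drops that are not even-odd drops, and the empty products (for k = 0 or k = 2n−1) equal 1. -/
open Finset

open scoped Classical

/-- `d(2n,k)`: the number of permutations of `[2n]` with exactly `k` drops that are not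
even-odd drops. -/
noncomputable def dNum (n k : ℕ) : ℕ :=
  Nat.card {σ : Equiv.Perm {x // x ∈ Finset.Icc 1 (2 * n)} //
    (Finset.univ.filter fun i : {x // x ∈ Finset.Icc 1 (2 * n)} =>
      (σ i : ℕ) < (i : ℕ) ∧ ¬(Even (i : ℕ) ∧ Odd ((σ i : ℕ)))).card = k}

section ChainCover

variable {V C : Type*} [LinearOrder V] [Fintype V]

/-- Sends `v` to the largest smaller element of its colour class, or to its colour if there is
none. -/
noncomputable def predMap (f : V → C) (v : V) : V ⊕ C :=
  if h : (univ.filter fun u => u < v ∧ f u = f v).Nonempty then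
    Sum.inl ((univ.filter fun u => u < v ∧ f u = f v).max' h)
  else Sum.inr (f v)

theorem predMap_eq_inl {f : V → C} {u v : V} :
    predMap f v = Sum.inl u ↔ (u < v ∧ f u = f v) ∧ ∀ w, w < v → f w = f v → w ≤ u := by
  unfold predMap
  split_ifs with h
  · rw [Sum.inl.injEq, Finset.max'_eq_iff]
    simp only [mem_filter, mem_univ, true_and, and_imp]
  · simp only [false_iff]
    rintro ⟨hu, -⟩
    exact h ⟨u, by simpa using hu⟩

theorem predMap_eq_inr {f : V → C} {c : C} {v : V} :
    predMap f v = Sum.inr c ↔ f v = c ∧ ∀ w, w < v → f w ≠ f v := by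
  unfold predMap
  split_ifs with h
  · simp only [false_iff]
    rintro ⟨-, hw⟩
    obtain ⟨u, hu⟩ := h
    simp only [mem_filter, mem_univ, true_and] at hu
    exact hw u hu.1 hu.2
  · rw [Sum.inr.injEq]
    refine ⟨fun hc => ⟨hc, fun w hw hf => h ⟨w, by simp [hw, hf]⟩⟩, fun hc => hc.1⟩

theorem predMap_injective (f : V → C) : Function.Injective (predMap f) := by
  have key : ∀ v v', predMap f v = predMap f v' → ¬ v < v' := by
    intro v v' h hlt
    rcases hv : predMap f v with u | c
    · have h1 := predMap_eq_inl.1 hv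
      have h2 := predMap_eq_inl.1 (h ▸ hv)
      exact absurd (h2.2 v hlt (h1.1.2.symm.trans h2.1.2)) (not_le.2 h1.1.1)
    · have h1 := predMap_eq_inr.1 hv
      have h2 := predMap_eq_inr.1 (h ▸ hv)
      exact h2.2 v hlt (h1.1.trans h2.1.symm)
  exact fun v v' h => le_antisymm (not_lt.1 (key v' v h.symm)) (not_lt.1 (key v v' h))

theorem predMap_left_injective : Function.Injective (predMap : (V → C) → V → V ⊕ C) := by
  intro f g h
  funext v
  induction v using WellFoundedLT.induction with
  | ind v ih =>
    rcases hv : predMap f v with u | c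
    · have h1 := predMap_eq_inl.1 hv
      have h2 := predMap_eq_inl.1 (show predMap g v = Sum.inl u from h ▸ hv)
      rw [← h1.1.2, ← h2.1.2, ih u h1.1.1]
    · have h1 := predMap_eq_inr.1 hv
      have h2 := predMap_eq_inr.1 (show predMap g v = Sum.inr c from h ▸ hv)
      rw [h1.1, h2.1]

/-- Follows the predecessors prescribed by `φ` until a colour is reached. -/
theorem exists_colouring (φ : V → V ⊕ C) (hφ : ∀ u v, φ v = Sum.inl u → u < v) :
    ∃ f : V → C, (∀ u v, φ v = Sum.inl u → f v = f u) ∧ ∀ c v, φ v = Sum.inr c → f v = c := by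
  let F : ∀ v, (∀ u, u < v → C) → C := fun v rec =>
    match h : φ v with
    | Sum.inl u => rec u (hφ u v h)
    | Sum.inr c => c
  refine ⟨wellFounded_lt.fix F, fun u v h => ?_, fun c v h => ?_⟩
  · rw [WellFounded.fix_eq]
    simp only [F]
    split
    · next w hw =>
      obtain rfl := Sum.inl_injective (hw.symm.trans h)
      rfl
    · simp_all
  · rw [WellFounded.fix_eq]
    simp only [F]
    split
    · simp_all
    · simp_all

theorem exists_predMap_eq {φ : V → V ⊕ C} (hinj : Function.Injective φ)
    (hφ : ∀ u v, φ v = Sum.inl u → u < v) : ∃ f : V → C, predMap f = φ := by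
  obtain ⟨f, hl, hr⟩ := exists_colouring φ hφ
  have bottom : ∀ u, ∃ b ≤ u, φ b = Sum.inr (f u) := by
    intro u
    induction u using WellFoundedLT.induction with
    | ind u ih =>
      rcases hu : φ u with w | c
      · obtain ⟨b, hb, hb'⟩ := ih w (hφ w u hu)
        exact ⟨b, hb.trans (hφ w u hu).le, by rw [hb', hl w u hu]⟩
      · exact ⟨u, le_rfl, by rw [hu, hr c u hu]⟩
  have main : ∀ v, ∀ u < v, f u = f v → ∃ w, φ v = Sum.inl w ∧ u ≤ w := by
    intro v
    induction v using WellFoundedLT.induction with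
    | ind v ihv =>
      rcases hv : φ v with w | c
      · intro u
        induction u using WellFoundedLT.induction with
        | ind u ihu =>
          intro huv hf
          refine ⟨w, rfl, not_lt.1 fun hwu => ?_⟩
          obtain ⟨w', hw', hle⟩ := ihv u huv w hwu (by rw [hf, hl w v hv])
          have hlt := hφ w' u hw'
          obtain ⟨w'', h1, h2⟩ := ihu w' hlt (hlt.trans huv) (by rw [← hl w' u hw', hf])
          obtain rfl := Sum.inl_injective h1
          obtain rfl := le_antisymm hle h2
          exact huv.ne (hinj (hw'.trans hv.symm))
      · intro u huv hf
        obtain ⟨b, hb, hb'⟩ := bottom u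
        rw [hf, hr c v hv, ← hv] at hb'
        exact absurd (hinj hb') (hb.trans_lt huv).ne
  refine ⟨f, funext fun v => ?_⟩
  rcases hv : φ v with u | c
  · refine predMap_eq_inl.2 ⟨⟨hφ u v hv, (hl u v hv).symm⟩, fun w hw hf => ?_⟩
    obtain ⟨w', h1, h2⟩ := main v w hw hf
    rw [hv] at h1
    exact h2.trans_eq (Sum.inl_injective h1).symm
  · refine predMap_eq_inr.2 ⟨hr c v hv, fun w hw hf => ?_⟩
    obtain ⟨w', h1, -⟩ := main v w hw hf
    rw [hv] at h1
    cases h1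

theorem rel_of_predMap {R : V → V → Prop} (htrans : ∀ u v w, R u v → R v w → R u w) {f : V → C}
    (h : ∀ u v, predMap f v = Sum.inl u → R u v) (v : V) : ∀ u < v, f u = f v → R u v := by
  induction v using WellFoundedLT.induction with
  | ind v ih =>
    intro u huv hf
    rcases hv : predMap f v with w | c
    · obtain ⟨⟨hw, hfw⟩, hmax⟩ := predMap_eq_inl.1 hv
      rcases (hmax u huv hf).eq_or_lt with rfl | hlt
      · exact h _ _ hv
      · exact htrans u w v (ih w hw u hlt (hf.trans hfw.symm)) (h _ _ hv)
    · exact absurd hf ((predMap_eq_inr.1 hv).2 u huv)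

/-- Colourings whose colour classes are chains for `R` correspond to injective choices, for each
vertex, of an `R`-smaller vertex or a colour. -/
theorem card_chain_colourings {R : V → V → Prop} (hlt : ∀ u v, R u v → u < v)
    (htrans : ∀ u v w, R u v → R v w → R u w) :
    Nat.card {f : V → C // ∀ u v, u < v → f u = f v → R u v} =
      Nat.card {φ : V ↪ V ⊕ C // ∀ u v, φ v = Sum.inl u → R u v} := by
  refine Nat.card_eq_of_bijective (fun f => ⟨⟨predMap f.1, predMap_injective f.1⟩, fun u v h =>
      f.2 u v (predMap_eq_inl.1 h).1.1 (predMap_eq_inl.1 h).1.2⟩) ⟨fun f g h => ?_, fun φ => ?_⟩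
  · exact Subtype.ext (predMap_left_injective
      (congrArg (fun e : V ↪ V ⊕ C => (e : V → V ⊕ C)) (congrArg Subtype.val h)))
  · obtain ⟨f, hf⟩ := exists_predMap_eq φ.1.injective fun u v h => hlt u v (φ.2 u v h)
    refine ⟨⟨f, fun u v => rel_of_predMap htrans (fun u v h => φ.2 u v ?_) v u⟩, ?_⟩
    · rw [← hf]; exact h
    · exact Subtype.ext (DFunLike.ext' hf)

end ChainCover

section Rook

variable {V C : Type*} [Fintype V] [Fintype C]

theorem card_perm_extending (R : V → V → Prop) (A : Finset V) :
    Fintype.card {σ : Equiv.Perm V // ∀ v ∈ A, R (σ v) v} =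
      Fintype.card {e : {v // v ∈ A} ↪ V // ∀ v, R (e v) v} *
        (Fintype.card V - A.card).factorial := by
  let E : {σ : Equiv.Perm V // ∀ v ∈ A, R (σ v) v} ≃
      Σ e : {e : {v // v ∈ A} ↪ V // ∀ v, R (e v) v},
        ({v // v ∉ A} ↪ ↥(Set.range e.1)ᶜ) :=
    ((((Equiv.embeddingEquivOfFinite V).symm.trans
      (Equiv.embeddingCongr (Equiv.sumCompl (· ∈ A)).symm (Equiv.refl V))).trans
      Equiv.sumEmbeddingEquivSigmaEmbeddingRestricted).subtypeEquiv
        (q := fun x : Σ e : {v // v ∈ A} ↪ V, {v // v ∉ A} ↪ ↥(Set.range e)ᶜ =>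
          ∀ v, R (x.1 v) v) (by
          intro σ
          simp only [Subtype.forall]
          rfl)).trans
      (Equiv.subtypeSigmaEquiv (fun e : {v // v ∈ A} ↪ V => {v // v ∉ A} ↪ ↥(Set.range e)ᶜ)
        (fun e => ∀ v, R (e v) v))
  rw [Fintype.card_congr E, Fintype.card_sigma]
  rw [Finset.sum_congr rfl (g := fun _ => (Fintype.card V - A.card).factorial)]
  · simp
  · intro e _
    rw [Fintype.card_embedding_eq, Fintype.card_compl_set, Set.card_range_of_injective e.1.injective,
      Fintype.card_subtype_compl]
    simp [Nat.descFactorial_self]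

theorem card_embedding_sum_fiber (R : V → V → Prop) (A : Finset V) :
    Fintype.card {φ : {φ : V ↪ V ⊕ C // ∀ u v, φ v = Sum.inl u → R u v} //
        (univ.filter fun v => (φ.1 v).isLeft) = A} =
      Fintype.card {e : {v // v ∈ A} ↪ V // ∀ v, R (e v) v} *
        (Fintype.card C).descFactorial (Fintype.card V - A.card) := by
  have hcard : (Fintype.card C).descFactorial (Fintype.card V - A.card) =
      Fintype.card ({v // v ∉ A} ↪ C) := by
    rw [Fintype.card_embedding_eq, Fintype.card_subtype_compl, Fintype.card_coe]
  rw [hcard, ← Fintype.card_prod]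
  symm
  let F : {e : {v // v ∈ A} ↪ V // ∀ v, R (e v) v} × ({v // v ∉ A} ↪ C) → V → V ⊕ C :=
    fun x v => if h : v ∈ A then Sum.inl (x.1.1 ⟨v, h⟩) else Sum.inr (x.2 ⟨v, h⟩)
  have hFl : ∀ x v (h : v ∈ A), F x v = Sum.inl (x.1.1 ⟨v, h⟩) := fun x v h => dif_pos h
  have hFr : ∀ x v (h : v ∉ A), F x v = Sum.inr (x.2 ⟨v, h⟩) := fun x v h => dif_neg h
  have hinj : ∀ x, Function.Injective (F x) := by
    intro x u v huv
    by_cases hu : u ∈ A <;> by_cases hv : v ∈ A <;> simp [F, hu, hv] at huv <;> exact huv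
  refine Fintype.card_of_bijective (f := fun x => ⟨⟨⟨F x, hinj x⟩, ?_⟩, ?_⟩) ⟨?_, ?_⟩
  · intro u v h
    replace h : F x v = Sum.inl u := h
    by_cases hv : v ∈ A
    · rw [hFl x v hv] at h
      rw [← Sum.inl_injective h]
      exact x.1.2 ⟨v, hv⟩
    · rw [hFr x v hv] at h
      cases h
  · ext v
    simp only [mem_filter, mem_univ, true_and]
    change (F x v).isLeft = true ↔ _
    by_cases hv : v ∈ A <;> simp [F, hv]
  · intro x y hxy
    have hF : F x = F y := by
      have := congrArg (fun z => (z.1.1 : V → V ⊕ C)) hxy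
      exact this
    refine Prod.ext (Subtype.ext (DFunLike.ext _ _ fun v => ?_)) (DFunLike.ext _ _ fun v => ?_)
    · have := congrFun hF v.1
      rw [hFl x v.1 v.2, hFl y v.1 v.2] at this
      exact Sum.inl_injective this
    · have := congrFun hF v.1
      rw [hFr x v.1 v.2, hFr y v.1 v.2] at this
      exact Sum.inr_injective this
  · rintro ⟨⟨φ, hφ⟩, rfl⟩
    have hl : ∀ v : {v // v ∈ univ.filter fun v => (φ v).isLeft}, ∃ u, φ v.1 = Sum.inl u :=
      fun v => Sum.isLeft_iff.1 (mem_filter.1 v.2).2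
    have hr : ∀ v : {v // v ∉ univ.filter fun v => (φ v).isLeft}, ∃ c, φ v.1 = Sum.inr c :=
      fun v => Sum.isRight_iff.1 (Sum.not_isLeft.1 fun h => v.2 (mem_filter.2 ⟨mem_univ _, h⟩))
    choose e he using hl
    choose g hg using hr
    refine ⟨⟨⟨⟨e, fun u v huv => ?_⟩, fun v => hφ _ _ (he v)⟩, ⟨g, fun u v huv => ?_⟩⟩, ?_⟩
    · exact Subtype.ext (φ.injective (by rw [he, he, huv]))
    · exact Subtype.ext (φ.injective (by rw [hg, hg, huv]))
    · refine Subtype.ext (Subtype.ext (DFunLike.ext _ _ fun v => ?_))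
      change F _ v = φ v
      by_cases hv : v ∈ univ.filter fun v => (φ v).isLeft
      · rw [hFl _ v hv]
        exact (he ⟨v, hv⟩).symm
      · rw [hFr _ v hv]
        exact (hg ⟨v, hv⟩).symm

theorem add_choose_eq_sum_powerset (H : Finset V) (t : ℕ) :
    (t + H.card).choose (Fintype.card V) =
      ∑ A ∈ H.powerset, t.choose (Fintype.card V - A.card) := by
  rw [Finset.sum_powerset_apply_card (fun m => t.choose (Fintype.card V - m)), add_comm,
    Nat.add_choose_eq, Finset.Nat.sum_antidiagonal_eq_sum_range_succ_mk]
  symm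
  refine Finset.sum_subset (Finset.range_mono (Nat.succ_le_succ H.card_le_univ)) fun m _ hm => ?_
  rw [Nat.choose_eq_zero_of_lt (by simpa using hm), zero_smul]

/-- The Goldman–Joichi–White expansion of the number of extended rook placements. -/
theorem card_embedding_sum (R : V → V → Prop) :
    Nat.card {φ : V ↪ V ⊕ C // ∀ u v, φ v = Sum.inl u → R u v} =
      ∑ σ : Equiv.Perm V, (Fintype.card C + (univ.filter fun v => R (σ v) v).card).choose
        (Fintype.card V) := by
  have h1 : Fintype.card {φ : V ↪ V ⊕ C // ∀ u v, φ v = Sum.inl u → R u v} =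
      ∑ A : Finset V, Fintype.card {e : {v // v ∈ A} ↪ V // ∀ v, R (e v) v} *
        (Fintype.card C).descFactorial (Fintype.card V - A.card) := by
    rw [← Fintype.card_congr (Equiv.sigmaFiberEquiv fun φ :
      {φ : V ↪ V ⊕ C // ∀ u v, φ v = Sum.inl u → R u v} =>
        univ.filter fun v => (φ.1 v).isLeft), Fintype.card_sigma]
    exact Finset.sum_congr rfl fun A _ => card_embedding_sum_fiber R A
  rw [Nat.card_eq_fintype_card, h1]
  simp only [add_choose_eq_sum_powerset]
  rw [Finset.sum_comm' (t' := univ)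
    (s' := fun A => univ.filter fun σ : Equiv.Perm V => ∀ v ∈ A, R (σ v) v)]
  · refine Finset.sum_congr rfl fun A _ => ?_
    rw [Finset.sum_const, ← Fintype.card_subtype, card_perm_extending, smul_eq_mul, mul_assoc,
      Nat.descFactorial_eq_factorial_mul_choose]
  · intro σ A
    simp [Finset.subset_iff]

end Rook

section BondLattice

variable {V : Finset ℕ} {C : Type*}

theorem ferrers_adj {u v : ℕ} : (ferrers V).Adj u v ↔ u ∈ V ∧ v ∈ V ∧
    ((u < v ∧ Odd u ∧ Even v) ∨ (v < u ∧ Odd v ∧ Even u)) := by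
  unfold ferrers
  rw [SimpleGraph.fromRel_adj]
  constructor
  · rintro ⟨-, h | h⟩ <;> tauto
  · rintro ⟨hu, hv, h | h⟩
    · exact ⟨h.1.ne, Or.inl ⟨hu, hv, h⟩⟩
    · exact ⟨h.1.ne', Or.inr ⟨hv, hu, h⟩⟩

/-- The monochromatic edges of the Ferrers graph under a colouring. -/
def monoGraph (f : {x // x ∈ V} → C) : SimpleGraph ℕ where
  Adj u v := (ferrers V).Adj u v ∧ ∀ (hu : u ∈ V) (hv : v ∈ V), f ⟨u, hu⟩ = f ⟨v, hv⟩
  symm := ⟨fun _ _ h => ⟨h.1.symm, fun hu hv => (h.2 hv hu).symm⟩⟩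
  loopless := ⟨fun _ h => h.1.ne rfl⟩

/-- The partition of `V` into the components of the monochromatic subgraph. -/
noncomputable def monoPartition (f : {x // x ∈ V} → C) : Finpartition V :=
  Finpartition.ofSetSetoid (monoGraph f).reachableSetoid V

theorem mem_part_monoPartition {f : {x // x ∈ V} → C} {u v : ℕ} :
    v ∈ (monoPartition f).part u ↔ u ∈ V ∧ v ∈ V ∧ (monoGraph f).Reachable u v :=
  Finpartition.mem_part_ofSetSetoid_iff_rel V

theorem eq_of_monoGraph_reachable {f : {x // x ∈ V} → C} {u v : ℕ}
    (h : (monoGraph f).Reachable u v) (hu : u ∈ V) :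
    ∃ hv : v ∈ V, f ⟨u, hu⟩ = f ⟨v, hv⟩ := by
  obtain ⟨p⟩ := h
  induction p with
  | nil => exact ⟨hu, rfl⟩
  | cons hadj _ ih =>
    have hm := (ferrers_adj.1 hadj.1).2.1
    obtain ⟨hv, h⟩ := ih hm
    exact ⟨hv, (hadj.2 hu hm).trans h⟩

theorem isBond_monoPartition (f : {x // x ∈ V} → C) : IsBond V (monoPartition f) := by
  intro B hB
  obtain ⟨b, hb⟩ := (monoPartition f).nonempty_of_mem_parts hB
  have hbV : b ∈ V := (monoPartition f).le hB hb
  have hpart := (monoPartition f).part_eq_of_mem hB hb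
  have reach : ∀ u v, (monoGraph f).Reachable u v → ∀ hu : u ∈ (B : Set ℕ),
      ∃ hv : v ∈ (B : Set ℕ), ((ferrers V).induce (B : Set ℕ)).Reachable ⟨u, hu⟩ ⟨v, hv⟩ := by
    rintro u v ⟨p⟩
    induction p with
    | nil => exact fun hu => ⟨hu, .refl _⟩
    | @cons u w v hadj _ ih =>
      intro hu
      have hw : w ∈ (B : Set ℕ) := by
        rw [Finset.mem_coe, ← hpart] at hu ⊢
        rw [mem_part_monoPartition] at hu ⊢
        exact ⟨hbV, (ferrers_adj.1 hadj.1).2.1, hu.2.2.trans hadj.reachable⟩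
      obtain ⟨hv, h⟩ := ih hw
      refine ⟨hv, SimpleGraph.Reachable.trans (SimpleGraph.Adj.reachable ?_) h⟩
      exact hadj.1
  have hbase : ∀ u : (B : Set ℕ), ((ferrers V).induce (B : Set ℕ)).Reachable ⟨b, hb⟩ u := by
    intro u
    have hu : u.1 ∈ (monoPartition f).part b := hpart ▸ u.2
    exact (reach b u (mem_part_monoPartition.1 hu).2.2 hb).2
  exact (SimpleGraph.connected_iff_exists_forall_reachable _).2 ⟨⟨b, hb⟩, hbase⟩

theorem le_monoPartition_iff {P : Finpartition V} (hP : IsBond V P) {f : {x // x ∈ V} → C} :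
    P ≤ monoPartition f ↔
      ∀ B ∈ P.parts, ∀ u v : {x // x ∈ V}, u.1 ∈ B → v.1 ∈ B → f u = f v := by
  constructor
  · intro h B hB u v hu hv
    obtain ⟨D, hD, hBD⟩ := h hB
    have hmem : v.1 ∈ (monoPartition f).part u.1 := by
      rw [(monoPartition f).part_eq_of_mem hD (hBD hu)]
      exact hBD hv
    exact (eq_of_monoGraph_reachable (mem_part_monoPartition.1 hmem).2.2 u.2).2
  · intro h B hB
    obtain ⟨b, hb⟩ := P.nonempty_of_mem_parts hB
    have hbV : b ∈ V := P.le hB hb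
    refine ⟨(monoPartition f).part b, (monoPartition f).part_mem.2 hbV, fun v hv => ?_⟩
    refine mem_part_monoPartition.2 ⟨hbV, P.le hB hv, ?_⟩
    let F : (ferrers V).induce (B : Set ℕ) →g monoGraph f :=
      { toFun := Subtype.val
        map_rel' := fun {x y} hxy => ⟨hxy, fun hx hy => h B hB ⟨x, hx⟩ ⟨y, hy⟩ x.2 y.2⟩ }
    exact ((hP B hB).preconnected ⟨b, hb⟩ ⟨v, hv⟩).map F

theorem monoPartition_eq_bot_iff {f : {x // x ∈ V} → C} :
    monoPartition f = ⊥ ↔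
      ∀ u v : {x // x ∈ V}, u < v → f u = f v → ¬(Odd (u : ℕ) ∧ Even (v : ℕ)) := by
  constructor
  · intro h u v huv hf hpar
    have hadj : (monoGraph f).Adj u v :=
      ⟨ferrers_adj.2 ⟨u.2, v.2, Or.inl ⟨huv, hpar⟩⟩, fun _ _ => hf⟩
    have hmem : v.1 ∈ (monoPartition f).part u.1 :=
      mem_part_monoPartition.2 ⟨u.2, v.2, hadj.reachable⟩
    have hu : u.1 ∈ (monoPartition f).part u.1 := (monoPartition f).mem_part u.2
    have hpart : (monoPartition f).part u.1 ∈ (monoPartition f).parts :=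
      (monoPartition f).part_mem.2 u.2
    generalize (monoPartition f).part u.1 = D at hmem hu hpart
    rw [h, Finpartition.mem_bot_iff] at hpart
    obtain ⟨a, -, rfl⟩ := hpart
    rw [mem_singleton] at hmem hu
    exact huv.ne (Subtype.ext (hu.trans hmem.symm))
  · intro h
    refine le_bot_iff.1 fun B hB => ?_
    obtain ⟨b, hb⟩ := (monoPartition f).nonempty_of_mem_parts hB
    have hbV := (monoPartition f).le hB hb
    refine ⟨{b}, Finpartition.mem_bot_iff.2 ⟨b, hbV, rfl⟩, fun v hv => ?_⟩
    rw [← (monoPartition f).part_eq_of_mem hB hb, mem_part_monoPartition] at hv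
    obtain ⟨-, -, ⟨p⟩⟩ := hv
    cases p with
    | nil => exact mem_singleton_self _
    | cons hadj _ =>
      obtain ⟨h1, h2, h3 | h3⟩ := ferrers_adj.1 hadj.1
      · exact absurd h3.2 (h ⟨_, h1⟩ ⟨_, h2⟩ h3.1 (hadj.2 h1 h2))
      · exact absurd h3.2 (h ⟨_, h2⟩ ⟨_, h1⟩ h3.1 (hadj.2 h1 h2).symm)

theorem card_constant_on_parts [Fintype C] (P : Finpartition V) :
    Fintype.card {f : {x // x ∈ V} → C //
        ∀ B ∈ P.parts, ∀ u v : {x // x ∈ V}, u.1 ∈ B → v.1 ∈ B → f u = f v} =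
      Fintype.card C ^ P.parts.card := by
  have hpow : Fintype.card C ^ P.parts.card = Fintype.card ({B // B ∈ P.parts} → C) := by
    rw [Fintype.card_fun, Fintype.card_coe]
  rw [hpow]
  symm
  refine Fintype.card_of_bijective
    (f := fun g => ⟨fun v => g ⟨P.part v, P.part_mem.2 v.2⟩, fun B hB u v hu hv => ?_⟩)
    ⟨fun g g' h => ?_, fun f => ?_⟩
  · exact congrArg g (Subtype.ext ((P.part_eq_of_mem hB hu).trans (P.part_eq_of_mem hB hv).symm))
  · funext B
    obtain ⟨b, hb⟩ := P.nonempty_of_mem_parts B.2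
    have := congrFun (congrArg Subtype.val h) ⟨b, P.le B.2 hb⟩
    have hB : (⟨P.part b, P.part_mem.2 (P.le B.2 hb)⟩ : {B // B ∈ P.parts}) = B :=
      Subtype.ext (P.part_eq_of_mem B.2 hb)
    simpa only [hB] using this
  · choose r hr using fun B : {B // B ∈ P.parts} => P.nonempty_of_mem_parts B.2
    refine ⟨fun B => f.1 ⟨r B, P.le B.2 (hr B)⟩, Subtype.ext (funext fun v => ?_)⟩
    exact f.2 (P.part v) (P.part_mem.2 v.2) _ _ (hr ⟨P.part v, _⟩) (P.mem_part v.2)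

theorem isBond_bot : IsBond V ⊥ := by
  intro B hB
  obtain ⟨a, -, rfl⟩ := Finpartition.mem_bot_iff.1 hB
  rw [coe_singleton]
  exact (SimpleGraph.connected_iff_exists_forall_reachable _).2
    ⟨⟨a, rfl⟩, fun u => by rw [Subsingleton.elim u ⟨a, rfl⟩]⟩

/-- The characteristic polynomial of the bond lattice counts proper colourings. -/
theorem sum_bond_mul_pow [Fintype C] {m : Finpartition V → ℤ}
    (hm : ∀ b, IsBond V b →
      ∑ c ∈ univ.filter (fun c => IsBond V c ∧ c ≤ b), m c = if b = ⊥ then 1 else 0) :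
    ∑ P ∈ univ.filter (fun P => IsBond V P), m P * (Fintype.card C : ℤ) ^ P.parts.card =
      Nat.card {f : {x // x ∈ V} → C //
        ∀ u v : {x // x ∈ V}, u < v → f u = f v → ¬(Odd (u : ℕ) ∧ Even (v : ℕ))} := by
  have h1 : ∀ P ∈ univ.filter (fun P => IsBond V P),
      m P * (Fintype.card C : ℤ) ^ P.parts.card =
        ∑ f : {x // x ∈ V} → C, if P ≤ monoPartition f then m P else 0 := by
    intro P hP
    rw [← Finset.sum_filter, Finset.sum_const, nsmul_eq_mul, mul_comm, ← Nat.cast_pow,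
      ← card_constant_on_parts P, Fintype.card_subtype]
    simp only [le_monoPartition_iff (mem_filter.1 hP).2]
  rw [Finset.sum_congr rfl h1, Finset.sum_comm]
  simp only [← Finset.sum_filter, Finset.filter_filter]
  rw [Finset.sum_congr rfl fun f _ => hm _ (isBond_monoPartition f), ← Finset.sum_filter]
  simp only [monoPartition_eq_bot_iff]
  rw [Finset.sum_const, Nat.card_eq_fintype_card, Fintype.card_subtype, nsmul_one]

end BondLattice

section Assembly

theorem card_hits_lt (V : Finset ℕ) (hV : V.Nonempty) (σ : Equiv.Perm {x // x ∈ V}) :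
    (univ.filter fun i : {x // x ∈ V} =>
      (σ i : ℕ) < (i : ℕ) ∧ ¬(Even (i : ℕ) ∧ Odd ((σ i : ℕ)))).card < V.card := by
  rw [← Fintype.card_coe V, ← Finset.card_univ]
  refine Finset.card_lt_card (Finset.ssubset_univ_iff.2 fun h => ?_)
  have hmem := h ▸ mem_univ (⟨V.min' hV, V.min'_mem hV⟩ : {x // x ∈ V})
  exact absurd (mem_filter.1 hmem).2.1 (not_lt.2 (V.min'_le _ (σ _).2))

theorem sum_bond_eq_sum_perm {V : Finset ℕ} {m : Finpartition V → ℤ}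
    (hm : ∀ b, IsBond V b →
      ∑ c ∈ univ.filter (fun c => IsBond V c ∧ c ≤ b), m c = if b = ⊥ then 1 else 0) (t : ℕ) :
    ∑ P ∈ univ.filter (fun P => IsBond V P), m P * (t : ℤ) ^ P.parts.card =
      ∑ σ : Equiv.Perm {x // x ∈ V}, ((t + (univ.filter fun i : {x // x ∈ V} =>
        (σ i : ℕ) < (i : ℕ) ∧ ¬(Even (i : ℕ) ∧ Odd ((σ i : ℕ)))).card).choose V.card : ℤ) := by
  have h1 := sum_bond_mul_pow (C := Fin t) hm
  let R : {x // x ∈ V} → {x // x ∈ V} → Prop :=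
    fun u v => (u : ℕ) < v ∧ ¬(Even (v : ℕ) ∧ Odd (u : ℕ))
  have h2 := card_chain_colourings (C := Fin t) (R := R)
    (fun u v h => h.1) (fun u v w huv hvw => ⟨huv.1.trans hvw.1, fun hp => by
      rcases Nat.even_or_odd (v : ℕ) with hv | hv
      · exact huv.2 ⟨hv, hp.2⟩
      · exact hvw.2 ⟨hp.1, hv⟩⟩)
  have h3 := card_embedding_sum (C := Fin t) R
  rw [Fintype.card_fin, Fintype.card_coe] at h3
  rw [Fintype.card_fin] at h1
  rw [h1, ← Nat.cast_sum]
  congr 1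
  refine Eq.trans ?_ (h2.trans (h3.trans (Finset.sum_congr (by ext; simp) fun σ _ => ?_)))
  swap
  · congr
  refine Nat.card_congr (Equiv.subtypeEquivRight fun f => ?_)
  refine forall₂_congr fun u v => forall₂_congr fun huv _ => ?_
  rw [and_comm (a := Odd _)]
  exact ⟨fun h => ⟨huv, h⟩, fun h => h.2⟩

theorem factorial_mul_choose_eq_prod (t k l : ℕ) :
    ((k + 1 + l).factorial : ℤ) * ((t + k).choose (k + 1 + l) : ℤ) =
      t * ((∏ i ∈ range k, ((t : ℤ) + (i + 1))) * ∏ i ∈ range l, ((t : ℤ) - (i + 1))) := by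
  rw [← Nat.cast_mul, ← Nat.descFactorial_eq_factorial_mul_choose,
    ← descPochhammer_eval_eq_descFactorial, descPochhammer_eval_eq_prod_range,
    Finset.prod_range_add, Finset.prod_range_succ, ← Finset.prod_range_reflect]
  have h1 : ∏ j ∈ range k, (((t + k : ℕ) : ℤ) - ((k - 1 - j : ℕ) : ℤ)) =
      ∏ i ∈ range k, ((t : ℤ) + (i + 1)) := by
    refine Finset.prod_congr rfl fun j hj => ?_
    have := mem_range.1 hj
    omega
  have h2 : ∏ x ∈ range l, (((t + k : ℕ) : ℤ) - ((k + 1 + x : ℕ) : ℤ)) =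
      ∏ i ∈ range l, ((t : ℤ) - (i + 1)) :=
    Finset.prod_congr rfl fun j _ => by push_cast; ring
  rw [h1, h2]
  push_cast
  ring

theorem sum_perm_eq_sum_dNum (n : ℕ) (hn : 1 ≤ n) (g : ℕ → ℤ) :
    ∑ σ : Equiv.Perm {x // x ∈ Finset.Icc 1 (2 * n)},
      g (univ.filter fun i : {x // x ∈ Finset.Icc 1 (2 * n)} =>
        (σ i : ℕ) < (i : ℕ) ∧ ¬(Even (i : ℕ) ∧ Odd ((σ i : ℕ)))).card =
      ∑ k ∈ range (2 * n), (dNum n k : ℤ) * g k := by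
  rw [← Finset.sum_fiberwise_of_maps_to (t := range (2 * n))
    (g := fun σ : Equiv.Perm {x // x ∈ Finset.Icc 1 (2 * n)} =>
      (univ.filter fun i : {x // x ∈ Finset.Icc 1 (2 * n)} =>
        (σ i : ℕ) < (i : ℕ) ∧ ¬(Even (i : ℕ) ∧ Odd ((σ i : ℕ)))).card)]
  · refine Finset.sum_congr rfl fun k _ => ?_
    rw [Finset.sum_congr rfl (g := fun _ => g k) fun σ hσ => by rw [(mem_filter.1 hσ).2],
      Finset.sum_const, nsmul_eq_mul, dNum, Nat.card_eq_fintype_card, Fintype.card_subtype]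
  · intro σ _
    have := card_hits_lt (Finset.Icc 1 (2 * n)) ⟨1, by simp; omega⟩ σ
    simpa using this

end Assembly

open Polynomial in
/-- `(2n)! χ_{2n}(t) = Σ_{k=0}^{2n-1} d(2n,k) (t+1)⋯(t+k) (t-1)⋯(t-(2n-1-k))`.  Here `μ` is
any function satisfying the defining recurrence of the Möbius function of the bond lattice of
`Γ_{2n}`, and `χ_{2n}(t) = Σ_π μ(0̂,π) t^{b(π)-1}`. -/
theorem stmt18 (n : ℕ) (hn : 1 ≤ n)
    (μ : Finpartition (Finset.Icc 1 (2 * n)) → Finpartition (Finset.Icc 1 (2 * n)) → ℤ)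
    (hμ : ∀ a b : Finpartition (Finset.Icc 1 (2 * n)),
      IsBond (Finset.Icc 1 (2 * n)) a → IsBond (Finset.Icc 1 (2 * n)) b → a ≤ b →
      (∑ c ∈ Finset.univ.filter fun c => IsBond (Finset.Icc 1 (2 * n)) c ∧ a ≤ c ∧ c ≤ b,
        μ a c) = if a = b then 1 else 0) :
    Polynomial.C ((Nat.factorial (2 * n) : ℤ)) *
      (∑ P ∈ Finset.univ.filter
          fun P : Finpartition (Finset.Icc 1 (2 * n)) => IsBond (Finset.Icc 1 (2 * n)) P,
        Polynomial.C (μ ⊥ P) * Polynomial.X ^ (P.parts.card - 1)) =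
      ∑ k ∈ Finset.range (2 * n),
        Polynomial.C ((dNum n k : ℤ)) *
          (∏ i ∈ Finset.range k, (Polynomial.X + Polynomial.C ((i : ℤ) + 1))) *
          (∏ i ∈ Finset.range (2 * n - 1 - k),
            (Polynomial.X - Polynomial.C ((i : ℤ) + 1))) := by
  have hm : ∀ b, IsBond (Finset.Icc 1 (2 * n)) b →
      ∑ c ∈ univ.filter (fun c => IsBond (Finset.Icc 1 (2 * n)) c ∧ c ≤ b), μ ⊥ c =
        if b = ⊥ then 1 else 0 := by
    intro b hb
    simpa only [bot_le, true_and, eq_comm (a := (⊥ : Finpartition _))] using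
      hμ ⊥ b isBond_bot hb bot_le
  refine mul_left_cancel₀ (Polynomial.X_ne_zero (R := ℤ))
    (Polynomial.eq_of_infinite_eval_eq _ _
      ((Set.infinite_range_of_injective (Nat.cast_injective (R := ℤ))).mono ?_))
  rintro _ ⟨t, rfl⟩
  have hcount := (sum_bond_eq_sum_perm hm t).trans
    (sum_perm_eq_sum_dNum n hn fun k => ((t + k).choose (Finset.Icc 1 (2 * n)).card : ℤ))
  have hL : (t : ℤ) * ∑ P ∈ univ.filter (fun P => IsBond (Finset.Icc 1 (2 * n)) P),
      μ ⊥ P * (t : ℤ) ^ (P.parts.card - 1) =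
      ∑ P ∈ univ.filter (fun P => IsBond (Finset.Icc 1 (2 * n)) P),
        μ ⊥ P * (t : ℤ) ^ P.parts.card := by
    rw [Finset.mul_sum]
    refine Finset.sum_congr rfl fun P _ => ?_
    have hpos : P.parts.card ≠ 0 :=
      (Finset.card_pos.2 ⟨_, P.part_mem.2 (Finset.mem_Icc.2 ⟨le_rfl, by omega⟩)⟩).ne'
    rw [mul_left_comm, mul_pow_sub_one hpos]
  simp only [Set.mem_ofPred_eq, Polynomial.eval_mul, Polynomial.eval_X, Polynomial.eval_C,
    Polynomial.eval_finsetSum, Polynomial.eval_pow, Polynomial.eval_prod,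
    Polynomial.eval_add, Polynomial.eval_sub]
  rw [mul_left_comm, hL, hcount, Finset.mul_sum, Finset.mul_sum, Nat.card_Icc,
    Nat.add_sub_cancel]
  refine Finset.sum_congr rfl fun k hk => ?_
  have hsplit : k + 1 + (2 * n - 1 - k) = 2 * n := by
    have := Finset.mem_range.1 hk
    omega
  have hprod := factorial_mul_choose_eq_prod t k (2 * n - 1 - k)
  rw [hsplit] at hprod
  rw [mul_left_comm, hprod]
  ring
end

section
/- For all n ≥ 1, the median Genocchi number h_n equals the number of permutations σ of [2n] all of whose drops are even-odd drops; that is, the number of permutations σ of [2n] such that i > σ(i) holds only when i is even and σ(i) is odd equals the number of Dumont derangements on [2n+2]. -/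
open Finset

/-- Permutations of `[i + k]`, viewed as permutations of `ℕ`, in which `1, …, i` are constrained
letters and `i + 1, …, i + k` are interchangeable free letters: pairs of constrained letters obey
`r`, a constrained position sent to a free letter satisfies `p`, and a constrained value reached
from a free letter satisfies `q`. -/
def freeLetterPerms (r : ℕ → ℕ → Prop) (p q : ℕ → Prop) (i k : ℕ) : Set (Equiv.Perm ℕ) :=
  {σ | (∀ x, x ∉ Icc 1 (i + k) → σ x = x) ∧
    ∀ x ∈ Icc 1 (i + k), (x ≤ i → σ x ≤ i → r x (σ x)) ∧ (x ≤ i → i < σ x → p x) ∧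
      (i < x → σ x ≤ i → q (σ x))}

theorem perm_apply_mem_Icc {N : ℕ} {σ : Equiv.Perm ℕ} (h : ∀ x, x ∉ Icc 1 N → σ x = x) {x : ℕ} :
    σ x ∈ Icc 1 N ↔ x ∈ Icc 1 N := by
  constructor
  · intro hx
    by_contra hc
    exact hc (h x hc ▸ hx)
  · intro hx
    by_contra hc
    have := σ.injective (h _ hc)
    exact hc (this.symm ▸ hx)

theorem ncard_eq_natCard_perm_Icc (N : ℕ) (P : Equiv.Perm ℕ → Prop)
    (Q : Equiv.Perm {x // x ∈ Icc 1 N} → Prop)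
    (hPQ : ∀ τ : Equiv.Perm {x // x ∈ Icc 1 N}, Q τ ↔ P (Equiv.Perm.ofSubtype τ)) :
    {σ : Equiv.Perm ℕ | (∀ x, x ∉ Icc 1 N → σ x = x) ∧ P σ}.ncard = Nat.card {τ // Q τ} := by
  rw [← Nat.card_coe_set_eq]
  refine (Nat.card_congr (Equiv.trans
    ((Equiv.Perm.subtypeEquivSubtypePerm (· ∈ Icc 1 N)).subtypeEquiv (q := fun f => P f.1) ?_)
    (Equiv.subtypeSubtypeEquivSubtypeInter (fun f : Equiv.Perm ℕ => ∀ x, x ∉ Icc 1 N → f x = x)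
      P))).symm
  intro τ
  exact hPQ τ

theorem finite_freeLetterPerms (r : ℕ → ℕ → Prop) (p q : ℕ → Prop) (i k : ℕ) :
    (freeLetterPerms r p q i k).Finite := by
  have h : {σ : Equiv.Perm ℕ | ∀ x, x ∉ Icc 1 (i + k) → σ x = x}.Finite :=
    Set.finite_coe_iff.1 (Finite.of_equiv _
      (Equiv.Perm.subtypeEquivSubtypePerm (· ∈ Icc 1 (i + k))))
  exact h.subset fun σ hσ => hσ.1

theorem ncard_freeLetterPerms_zero_left (r : ℕ → ℕ → Prop) (p q : ℕ → Prop) (k : ℕ) :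
    (freeLetterPerms r p q 0 k).ncard = k.factorial := by
  have h : freeLetterPerms r p q 0 k =
      {σ | (∀ x, x ∉ Icc 1 k → σ x = x) ∧ True} := by
    ext σ
    simp only [freeLetterPerms, zero_add, Set.mem_ofPred_eq, and_true, and_iff_left_iff_imp]
    intro hσ x hx
    have h1 := (perm_apply_mem_Icc hσ).2 hx
    simp only [mem_Icc] at hx h1
    refine ⟨?_, ?_, ?_⟩ <;> intros <;> omega
  rw [h, ncard_eq_natCard_perm_Icc k (fun _ => True) (fun _ => True) (fun _ => Iff.rfl)]
  simp [Fintype.card_perm]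

section

variable {r : ℕ → ℕ → Prop} {p q : ℕ → Prop} {i k : ℕ}

/-- Exchanging free letters on either side preserves the constraints. -/
theorem swap_mul_mul_swap_mem {a b c d : ℕ} {σ : Equiv.Perm ℕ}
    (ha : a ∈ Ioc i (i + k)) (hb : b ∈ Ioc i (i + k)) (hc : c ∈ Ioc i (i + k))
    (hd : d ∈ Ioc i (i + k)) (hσ : σ ∈ freeLetterPerms r p q i k) :
    Equiv.swap b d * σ * Equiv.swap a c ∈ freeLetterPerms r p q i k := by
  obtain ⟨h1, h2⟩ := hσ
  simp only [mem_Ioc, mem_Icc] at ha hb hc hd h1 h2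
  refine ⟨fun x hx => ?_, fun x hx => ?_⟩ <;> rw [mem_Icc] at hx
  · have e1 : Equiv.swap a c x = x :=
      Equiv.swap_apply_of_ne_of_ne (by omega) (by omega)
    have e2 : Equiv.swap b d x = x :=
      Equiv.swap_apply_of_ne_of_ne (by omega) (by omega)
    simp only [Equiv.Perm.mul_apply, e1, h1 x hx, e2]
  · have h3 := h2 (Equiv.swap a c x)
    simp only [Equiv.Perm.mul_apply]
    generalize hz : σ (Equiv.swap a c x) = z at *
    have e1 : Equiv.swap a c x = x ∨ (i < x ∧ i < Equiv.swap a c x ∧ Equiv.swap a c x ≤ i + k) := by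
      rw [Equiv.swap_apply_def]; split_ifs <;> omega
    have e2 : Equiv.swap b d z = z ∨ (i < z ∧ i < Equiv.swap b d z) := by
      rw [Equiv.swap_apply_def]; split_ifs <;> omega
    generalize Equiv.swap a c x = y at *
    generalize Equiv.swap b d z = w at *
    grind

theorem mem_freeLetterPerms_succ_fix {σ : Equiv.Perm ℕ} :
    σ ∈ freeLetterPerms r p q i (k + 1) ∧ σ (i + k + 1) = i + k + 1 ↔
      σ ∈ freeLetterPerms r p q i k := by
  simp only [freeLetterPerms, Set.mem_ofPred_eq, mem_Icc]
  constructor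
  · rintro ⟨⟨h1, h2⟩, h3⟩
    refine ⟨fun x hx => ?_, fun x hx => h2 x (by omega)⟩
    by_cases hx' : x = i + k + 1
    · rw [hx', h3]
    · exact h1 x (by omega)
  · rintro ⟨h1, h2⟩
    have h3 := h1 (i + k + 1) (by omega)
    refine ⟨⟨fun x hx => h1 x (by omega), fun x hx => ?_⟩, h3⟩
    by_cases hx' : x = i + k + 1
    · rw [hx', h3]
      refine ⟨?_, ?_, ?_⟩ <;> intros <;> omega
    · exact h2 x (by omega)

theorem ncard_freeLetterPerms_apply_eq {a b : ℕ} (ha : a ∈ Ioc i (i + (k + 1)))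
    (hb : b ∈ Ioc i (i + (k + 1))) :
    {σ ∈ freeLetterPerms r p q i (k + 1) | σ a = b}.ncard =
      (freeLetterPerms r p q i k).ncard := by
  have hL : i + k + 1 ∈ Ioc i (i + (k + 1)) := by simp only [mem_Ioc]; omega
  refine Set.ncard_congr (fun σ _ => Equiv.swap b (i + k + 1) * σ * Equiv.swap a (i + k + 1))
    ?_ ?_ ?_
  · rintro σ ⟨hσ, hab⟩
    refine mem_freeLetterPerms_succ_fix.1 ⟨swap_mul_mul_swap_mem ha hb hL hL hσ, ?_⟩
    simp [hab]
  · intro σ τ _ _ h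
    exact mul_left_cancel (mul_right_cancel h)
  · intro τ hτ
    obtain ⟨h1, h2⟩ := mem_freeLetterPerms_succ_fix.2 hτ
    refine ⟨Equiv.swap b (i + k + 1) * τ * Equiv.swap a (i + k + 1),
      ⟨swap_mul_mul_swap_mem ha hb hL hL h1, ?_⟩, ?_⟩
    · simp [h2]
    · ext x
      simp

theorem ncard_freeLetterPerms_apply_mem {a : ℕ} {B : Finset ℕ} (ha : a ∈ Ioc i (i + (k + 1)))
    (hB : B ⊆ Ioc i (i + (k + 1))) :
    {σ ∈ freeLetterPerms r p q i (k + 1) | σ a ∈ B}.ncard =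
      #B * (freeLetterPerms r p q i k).ncard := by
  induction B using Finset.induction_on with
  | empty => simp
  | insert b B hb ih =>
    have h : {σ ∈ freeLetterPerms r p q i (k + 1) | σ a ∈ insert b B} =
        {σ ∈ freeLetterPerms r p q i (k + 1) | σ a = b} ∪
          {σ ∈ freeLetterPerms r p q i (k + 1) | σ a ∈ B} := by
      ext σ
      simp only [Set.mem_ofPred_eq, Set.mem_union, mem_insert]
      tauto
    have hf := finite_freeLetterPerms r p q i (k + 1)
    rw [h, Set.ncard_union_eq _ (hf.subset fun σ h => h.1) (hf.subset fun σ h => h.1),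
      ncard_freeLetterPerms_apply_eq ha (hB (mem_insert_self b B)),
      ih ((subset_insert b B).trans hB), card_insert_of_notMem hb]
    · ring
    · rw [Set.disjoint_left]
      rintro σ ⟨_, h1⟩ ⟨_, h2⟩
      exact hb (h1 ▸ h2)

theorem ncard_freeLetterPerms_symm_mem {b : ℕ} {A : Finset ℕ} (hb : b ∈ Ioc i (i + (k + 1)))
    (hA : A ⊆ Ioc i (i + (k + 1))) :
    {σ ∈ freeLetterPerms r p q i (k + 1) | σ.symm b ∈ A}.ncard =
      #A * (freeLetterPerms r p q i k).ncard := by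
  induction A using Finset.induction_on with
  | empty => simp
  | insert a A ha ih =>
    have h : {σ ∈ freeLetterPerms r p q i (k + 1) | σ.symm b ∈ insert a A} =
        {σ ∈ freeLetterPerms r p q i (k + 1) | σ a = b} ∪
          {σ ∈ freeLetterPerms r p q i (k + 1) | σ.symm b ∈ A} := by
      ext σ
      simp only [Set.mem_ofPred_eq, Set.mem_union, mem_insert, Equiv.symm_apply_eq, eq_comm (a := b),
        and_or_left]
    have hf := finite_freeLetterPerms r p q i (k + 1)
    rw [h, Set.ncard_union_eq _ (hf.subset fun σ h => h.1) (hf.subset fun σ h => h.1),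
      ncard_freeLetterPerms_apply_eq (hA (mem_insert_self a A)) hb,
      ih ((subset_insert a A).trans hA), card_insert_of_notMem ha]
    · ring
    · rw [Set.disjoint_left]
      rintro σ ⟨_, h1⟩ ⟨_, h2⟩
      rw [← h1, Equiv.symm_apply_apply] at h2
      exact ha h2

end

/-- Permutations with only even-odd drops, with `k` additional free letters. -/
def evenOddDropPerms (i k : ℕ) : Set (Equiv.Perm ℕ) :=
  freeLetterPerms (fun x y => y < x → Even x ∧ Odd y) (fun _ => True) Odd i k

/-- Dumont derangements with `k` additional free letters. -/
def dumontDerangements (i k : ℕ) : Set (Equiv.Perm ℕ) :=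
  freeLetterPerms (fun x y => (Even x → y < x) ∧ (Odd x → x < y)) Odd (fun _ => True) i k

theorem ncard_evenOddDropPerms_succ_of_even {i : ℕ} (hi : Even i) (k : ℕ) :
    (evenOddDropPerms (i + 1) k).ncard = (k + 1) * (evenOddDropPerms i k).ncard := by
  have hB : #(Ioc i (i + (k + 1))) = k + 1 := by simp
  rw [evenOddDropPerms, evenOddDropPerms, ← hB,
    ← ncard_freeLetterPerms_apply_mem (a := i + 1) (by simp) subset_rfl]
  congr 1
  ext σ
  simp only [freeLetterPerms, Set.mem_ofPred_eq, mem_Ioc, show i + 1 + k = i + (k + 1) by omega]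
  rw [and_assoc]
  refine and_congr_right fun hσ => ?_
  have hσ' := fun x => (perm_apply_mem_Icc hσ (x := x)).2
  simp only [mem_Icc] at hσ' ⊢
  constructor
  · intro h
    refine ⟨fun x hx => ?_, ?_⟩ <;> grind
  · rintro ⟨h1, h2⟩ x hx
    grind

theorem ncard_evenOddDropPerms_succ_of_odd {i : ℕ} (hi : Odd i) (k : ℕ) :
    (evenOddDropPerms (i + 1) k).ncard + k * (evenOddDropPerms i k).ncard =
      (evenOddDropPerms i (k + 1)).ncard := by
  have hA : #(Ioc (i + 1) (i + (k + 1))) = k := by simp; omega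
  have h := ncard_freeLetterPerms_symm_mem (r := fun x y => y < x → Even x ∧ Odd y)
    (p := fun _ => True) (q := Odd) (k := k) (b := i + 1) (by simp)
    (Ioc_subset_Ioc_left (Nat.le_succ i) : Ioc (i + 1) (i + (k + 1)) ⊆ _)
  rw [hA] at h
  rw [evenOddDropPerms, evenOddDropPerms, evenOddDropPerms, ← h, add_comm,
    ← Set.ncard_inter_add_ncard_sdiff_eq_ncard (freeLetterPerms _ _ _ i (k + 1))
      {σ : Equiv.Perm ℕ | σ.symm (i + 1) ∈ Ioc (i + 1) (i + (k + 1))}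
      (finite_freeLetterPerms _ _ _ _ _)]
  refine congrArg₂ (· + ·) rfl (congrArg Set.ncard ?_)
  ext σ
  simp only [freeLetterPerms, Set.mem_sdiff, Set.mem_ofPred_eq, mem_Ioc,
    show i + 1 + k = i + (k + 1) by omega]
  rw [and_assoc]
  refine and_congr_right fun hσ => ?_
  have hσ' := fun x => (perm_apply_mem_Icc hσ (x := x))
  have e := σ.apply_symm_apply (i + 1)
  have e' := σ.symm_apply_apply
  simp only [mem_Icc] at hσ' ⊢
  constructor
  · intro h
    refine ⟨fun x hx => ?_, ?_⟩ <;> grind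
  · rintro ⟨h1, h2⟩ x hx
    grind

theorem ncard_dumontDerangements_succ_of_even {i : ℕ} (hi : Even i) (k : ℕ) :
    (dumontDerangements (i + 1) k).ncard = k * (dumontDerangements i k).ncard := by
  have hB : #(Ioc (i + 1) (i + (k + 1))) = k := by simp; omega
  rw [dumontDerangements, dumontDerangements]
  nth_rw 2 [← hB]
  rw [← ncard_freeLetterPerms_apply_mem (a := i + 1) (by simp)
      (Ioc_subset_Ioc_left (Nat.le_succ i))]
  congr 1
  ext σ
  simp only [freeLetterPerms, Set.mem_ofPred_eq, mem_Ioc, show i + 1 + k = i + (k + 1) by omega]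
  rw [and_assoc]
  refine and_congr_right fun hσ => ?_
  have hσ' := fun x => (perm_apply_mem_Icc hσ (x := x)).2
  simp only [mem_Icc] at hσ' ⊢
  constructor
  · intro h
    refine ⟨fun x hx => ?_, ?_⟩ <;> grind
  · rintro ⟨h1, h2⟩ x hx
    grind

theorem ncard_dumontDerangements_succ_of_odd {i : ℕ} (hi : Odd i) (k : ℕ) :
    (dumontDerangements (i + 1) k).ncard + (k + 1) * (dumontDerangements i k).ncard =
      (dumontDerangements i (k + 1)).ncard := by
  have hA : #(Ioc i (i + (k + 1))) = k + 1 := by simp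
  have h := ncard_freeLetterPerms_apply_mem
    (r := fun x y => (Even x → y < x) ∧ (Odd x → x < y)) (p := Odd) (q := fun _ => True)
    (k := k) (a := i + 1) (B := Ioc i (i + (k + 1))) (by simp) subset_rfl
  rw [hA] at h
  rw [dumontDerangements, dumontDerangements, dumontDerangements, ← h, add_comm,
    ← Set.ncard_inter_add_ncard_sdiff_eq_ncard (freeLetterPerms _ _ _ i (k + 1))
      {σ : Equiv.Perm ℕ | σ (i + 1) ∈ Ioc i (i + (k + 1))}
      (finite_freeLetterPerms _ _ _ _ _)]
  refine congrArg₂ (· + ·) rfl (congrArg Set.ncard ?_)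
  ext σ
  simp only [freeLetterPerms, Set.mem_sdiff, Set.mem_ofPred_eq, mem_Ioc,
    show i + 1 + k = i + (k + 1) by omega]
  rw [and_assoc]
  refine and_congr_right fun hσ => ?_
  have hσ' := fun x => (perm_apply_mem_Icc hσ (x := x)).2
  simp only [mem_Icc] at hσ' ⊢
  constructor
  · intro h
    refine ⟨fun x hx => ?_, ?_⟩ <;> grind
  · rintro ⟨h1, h2⟩ x hx
    grind

theorem ncard_dumontDerangements_two_mul_add_two (m k : ℕ) :
    (dumontDerangements (2 * m + 2) k).ncard = (k + 1) * (evenOddDropPerms (2 * m) k).ncard := by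
  have hD (m k : ℕ) : (dumontDerangements (2 * m + 2) k).ncard +
      (k + 1) * (k * (dumontDerangements (2 * m) k).ncard) =
        (k + 1) * (dumontDerangements (2 * m) (k + 1)).ncard := by
    simpa only [ncard_dumontDerangements_succ_of_even (even_two_mul m)] using
      ncard_dumontDerangements_succ_of_odd (odd_two_mul_add_one m) k
  have hE (m k : ℕ) : (evenOddDropPerms (2 * m + 2) k).ncard +
      k * ((k + 1) * (evenOddDropPerms (2 * m) k).ncard) =
        (k + 1 + 1) * (evenOddDropPerms (2 * m) (k + 1)).ncard := by
    simpa only [ncard_evenOddDropPerms_succ_of_even (even_two_mul m)] using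
      ncard_evenOddDropPerms_succ_of_odd (odd_two_mul_add_one m) k
  induction m generalizing k with
  | zero =>
    have h := hD 0 k
    simp only [dumontDerangements, evenOddDropPerms, mul_zero, zero_add,
      ncard_freeLetterPerms_zero_left, Nat.factorial_succ] at h ⊢
    linarith
  | succ m ih =>
    have h := hD (m + 1) k
    rw [Nat.mul_succ, ih, ih] at h
    rw [Nat.mul_succ]
    zify at h ⊢
    have h' := hE m k
    zify at h'
    linear_combination h - (k + 1) * h'

theorem natCard_perm_Icc_eq_ncard_freeLetterPerms (N : ℕ) (r : ℕ → ℕ → Prop) (p q : ℕ → Prop) :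
    Nat.card {σ : Equiv.Perm {x // x ∈ Icc 1 N} // ∀ i : {x // x ∈ Icc 1 N}, r i (σ i)} =
      (freeLetterPerms r p q N 0).ncard := by
  rw [← ncard_eq_natCard_perm_Icc N (fun σ => ∀ x ∈ Icc 1 N, r x (σ x)) _ fun τ => ?_]
  · congr 1
    ext σ
    simp only [freeLetterPerms, Set.mem_ofPred_eq, add_zero]
    refine and_congr_right fun hσ => forall₂_congr fun x hx => ?_
    have h := (perm_apply_mem_Icc hσ).2 hx
    rw [mem_Icc] at hx h
    simp [hx.2, h.2, not_lt.2 hx.2, not_lt.2 h.2]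
  · rw [Subtype.forall]
    refine forall₂_congr fun x hx => ?_
    rw [Equiv.Perm.ofSubtype_apply_of_mem τ hx]

/-- The median Genocchi number `h_n` equals the number of permutations of `[2n]` all of whose
drops are even-odd drops. -/
theorem stmt19 (n : ℕ) (hn : 1 ≤ n) :
    Nat.card {σ : Equiv.Perm {x // x ∈ Finset.Icc 1 (2 * n)} //
        ∀ i : {x // x ∈ Finset.Icc 1 (2 * n)},
          (σ i : ℕ) < (i : ℕ) → Even (i : ℕ) ∧ Odd ((σ i : ℕ))} =
      medianGenocchi n := by
  have h := ncard_dumontDerangements_two_mul_add_two n 0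
  rw [zero_add, one_mul, dumontDerangements, evenOddDropPerms,
    ← natCard_perm_Icc_eq_ncard_freeLetterPerms,
    ← natCard_perm_Icc_eq_ncard_freeLetterPerms] at h
  exact h.symm
end
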